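/- The group of self-homeomorphisms of the Euclidean plane ℝ² is strongly distorted: there exist m ∈ ℕ and a sequence (w_n)_{n∈ℕ} of natural numbers such that for every sequence (g_n)_{n∈ℕ} of homeomorphisms of ℝ² there exists a subset S of Homeo(ℝ²) of cardinality m with g_n ∈ S^{w_n} for every n. -/

import Mathlib

open Pointwise

instance instGroupHomeomorph (X : Type*) [TopologicalSpace X] : Group (X ≃ₜ X) where
  mul f g := g.trans f
  one := Homeomorph.refl X
  inv := Homeomorph.symm
  mul_assoc _ _ _ := Homeomorph.ext fun _ => rfl
  one_mul _ := Homeomorph.ext fun _ => rfl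
  mul_one _ := Homeomorph.ext fun _ => rfl
  inv_mul_cancel f := Homeomorph.ext fun x => f.symm_apply_apply x

/-- A group `G` is *strongly distorted* if there exist `m : ℕ` and a sequence
`w : ℕ → ℕ` such that for every sequence `g : ℕ → G` there is a subset `S` of `G`
of cardinality `m` with `g n ∈ S ^ (w n)` for every `n`. -/
def StronglyDistorted (G : Type*) [Group G] : Prop :=
  ∃ (m : ℕ) (w : ℕ → ℕ), ∀ g : ℕ → G, ∃ S : Set G,
    S.Finite ∧ S.ncard = m ∧ ∀ n, g n ∈ S ^ w n

/-- Elements of a sequence in `Y` are values of words depending only on the index. -/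
def WordDistorted {G : Type*} [Group G] (Y : Set G) : Prop :=
  ∃ (r : ℕ) (W : ℕ → FreeGroup (Fin r)), ∀ y : ℕ → G, (∀ n, y n ∈ Y) →
    ∃ s : Fin r → G, ∀ n, y n = FreeGroup.lift s (W n)

namespace WordDistorted

variable {G : Type*} [Group G] {Y Y' : Set G}

theorem mono (h : WordDistorted Y) (hY : Y' ⊆ Y) : WordDistorted Y' := by
  obtain ⟨r, W, hW⟩ := h
  exact ⟨r, W, fun y hy => hW y fun n => hY (hy n)⟩

theorem of_words (h : WordDistorted Y') {r : ℕ} (V : ℕ → FreeGroup (ℕ ⊕ Fin r))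
    (hV : ∀ y : ℕ → G, (∀ n, y n ∈ Y) → ∃ (z : ℕ → G) (k : Fin r → G),
      (∀ n, z n ∈ Y') ∧ ∀ n, y n = FreeGroup.lift (Sum.elim z k) (V n)) :
    WordDistorted Y := by
  obtain ⟨r', W, hW⟩ := h
  refine ⟨r' + r, fun n => FreeGroup.lift (Sum.elim (fun m => FreeGroup.map (Fin.castAdd r) (W m))
    (fun j => FreeGroup.of (Fin.natAdd r' j))) (V n), fun y hy => ?_⟩
  obtain ⟨z, k, hz, hy'⟩ := hV y hy
  obtain ⟨s, hs⟩ := hW z hz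
  refine ⟨Fin.append s k, fun n => ?_⟩
  rw [hy' n]
  have key : (FreeGroup.lift (Fin.append s k)).comp
      (FreeGroup.lift (Sum.elim (fun m => FreeGroup.map (Fin.castAdd r) (W m))
        (fun j => FreeGroup.of (Fin.natAdd r' j)))) = FreeGroup.lift (Sum.elim z k) := by
    ext i
    rcases i with m | j
    · have : (FreeGroup.lift (Fin.append s k)).comp (FreeGroup.map (Fin.castAdd r)) =
          FreeGroup.lift s := by
        ext j; simp
      simpa [hs m] using DFunLike.congr_fun this (W m)
    · simp
  exact (DFunLike.congr_fun key (V n)).symm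

theorem mul (h : WordDistorted Y) (h' : WordDistorted Y') :
    WordDistorted {g | ∃ a ∈ Y, ∃ b ∈ Y', g = a * b} := by
  obtain ⟨r, W, hW⟩ := h
  obtain ⟨r', W', hW'⟩ := h'
  refine ⟨r + r', fun n => FreeGroup.map (Fin.castAdd r') (W n) *
    FreeGroup.map (Fin.natAdd r) (W' n), fun y hy => ?_⟩
  choose a ha b hb hab using hy
  obtain ⟨s, hs⟩ := hW a ha
  obtain ⟨s', hs'⟩ := hW' b hb
  refine ⟨Fin.append s s', fun n => ?_⟩
  have e1 : (FreeGroup.lift (Fin.append s s')).comp (FreeGroup.map (Fin.castAdd r')) =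
      FreeGroup.lift s := by
    ext j; simp
  have e2 : (FreeGroup.lift (Fin.append s s')).comp (FreeGroup.map (Fin.natAdd r)) =
      FreeGroup.lift s' := by
    ext j; simp
  rw [hab n, hs n, hs' n, map_mul, ← e1, ← e2]
  rfl

theorem conj (h : WordDistorted Y) (c : G) : WordDistorted {g | c⁻¹ * g * c ∈ Y} := by
  refine h.of_words (r := 1)
    (fun n => FreeGroup.of (.inr 0) * FreeGroup.of (.inl n) * (FreeGroup.of (.inr 0))⁻¹)
    fun y hy => ⟨fun n => c⁻¹ * y n * c, fun _ => c, hy, fun n => ?_⟩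
  simp [mul_assoc]

theorem exists_mem_pow_of_lift {r : ℕ} (s : Fin r → G) (w : FreeGroup (Fin r)) :
    FreeGroup.lift s w ∈
      (Set.range s ∪ Set.range (fun i => (s i)⁻¹)) ^ w.toWord.length := by
  have h : ∀ L : List (Fin r × Bool), FreeGroup.lift s (FreeGroup.mk L) ∈
      (Set.range s ∪ Set.range (fun i => (s i)⁻¹)) ^ L.length := by
    intro L
    induction L with
    | nil => simp
    | cons x L ih =>
      rw [FreeGroup.lift_mk] at ih ⊢
      rw [List.length_cons, pow_succ', List.map_cons, List.prod_cons]
      refine Set.mul_mem_mul ?_ ih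
      rcases x with ⟨i, _ | _⟩ <;> simp
  have := h w.toWord
  rwa [FreeGroup.mk_toWord] at this

/-- If a coset of a word distorted class fills up the group, the group is strongly distorted. -/
theorem stronglyDistorted [Infinite G] (h : WordDistorted Y) (c : G)
    (hc : ∀ g, g ∈ Y ∨ g * c ∈ Y) : StronglyDistorted G := by
  classical
  obtain ⟨r, W, hW⟩ := h
  refine ⟨r + r + 2, fun n => (W n).toWord.length + 1, fun g => ?_⟩
  obtain ⟨s, hs⟩ := hW (fun n => if g n ∈ Y then g n else g n * c) fun n => by
    by_cases hn : g n ∈ Y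
    · simp [hn]
    · simpa [hn] using (hc (g n)).resolve_left hn
  set S₀ : Finset G := Finset.univ.image s ∪ Finset.univ.image (fun i => (s i)⁻¹) ∪ {1, c⁻¹}
  have hcard : S₀.card ≤ r + r + 2 := by
    refine (Finset.card_union_le _ _).trans (add_le_add ((Finset.card_union_le _ _).trans
      (add_le_add ?_ ?_)) Finset.card_le_two)
    · exact Finset.card_image_le.trans (by simp)
    · exact Finset.card_image_le.trans (by simp)
  obtain ⟨S, hS, hSc⟩ := Infinite.exists_superset_card_eq S₀ _ hcard
  refine ⟨S, S.finite_toSet, by simpa using hSc, fun n => ?_⟩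
  have h1 : FreeGroup.lift s (W n) ∈ (S : Set G) ^ (W n).toWord.length := by
    refine Set.pow_subset_pow_left ?_ (exists_mem_pow_of_lift s (W n))
    rintro x (⟨i, rfl⟩ | ⟨i, rfl⟩) <;> exact hS (by simp [S₀])
  rw [← hs n] at h1
  rw [pow_succ]
  by_cases hn : g n ∈ Y
  · simp only [hn, if_true] at h1
    simpa using Set.mul_mem_mul h1 (show (1 : G) ∈ (S : Set G) from hS (by simp [S₀]))
  · simp only [hn, if_false] at h1
    simpa using Set.mul_mem_mul h1 (show c⁻¹ ∈ (S : Set G) from hS (by simp [S₀]))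

end WordDistorted

theorem StronglyDistorted.of_mulEquiv {G H : Type*} [Group G] [Group H] (e : G ≃* H)
    (h : StronglyDistorted G) : StronglyDistorted H := by
  obtain ⟨m, w, hw⟩ := h
  refine ⟨m, w, fun g => ?_⟩
  obtain ⟨S, hS, hc, hg⟩ := hw fun n => e.symm (g n)
  refine ⟨e '' S, hS.image e, by rw [Set.ncard_image_of_injective _ e.injective, hc], fun n => ?_⟩
  rw [← Set.image_pow]
  exact ⟨_, hg n, by simp⟩

section HomeomorphGroup

variable {X : Type*} [TopologicalSpace X]

theorem Homeomorph.group_mul_apply (f g : X ≃ₜ X) (x : X) : (f * g) x = f (g x) := rfl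

theorem Homeomorph.group_one_apply (x : X) : (1 : X ≃ₜ X) x = x := rfl

theorem Homeomorph.group_inv_apply_self (f : X ≃ₜ X) (x : X) : f⁻¹ (f x) = x :=
  f.symm_apply_apply x

theorem Homeomorph.group_apply_inv_self (f : X ≃ₜ X) (x : X) : f (f⁻¹ x) = x :=
  f.apply_symm_apply x

theorem Homeomorph.group_inv_apply_eq_iff (f : X ≃ₜ X) {x y : X} : f⁻¹ x = y ↔ x = f y :=
  f.symm_apply_eq

/-- Conjugation by a homeomorphism. -/
def Homeomorph.conjMulEquiv {Y : Type*} [TopologicalSpace Y] (e : X ≃ₜ Y) :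
    (X ≃ₜ X) ≃* (Y ≃ₜ Y) where
  toFun f := (e.symm.trans f).trans e
  invFun f := (e.trans f).trans e.symm
  left_inv f := by ext; simp
  right_inv f := by ext; simp
  map_mul' f g := by ext; simp

end HomeomorphGroup

section Glue

variable {X ι : Type*} [TopologicalSpace X]

theorem Homeomorph.level_of_support {idx : X → ι} {f : ι → X ≃ₜ X}
    (hf : ∀ i x, idx x ≠ i → f i x = x) (x : X) : idx (f (idx x) x) = idx x := by
  by_contra h
  have := hf _ _ h
  rw [(f (idx x)).injective this] at h
  exact h rfl

theorem continuous_glue [T2Space X] {idx : X → ι}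
    (hidx : LocallyFinite fun i => closure (idx ⁻¹' {i})) {f : ι → X → X}
    (hc : ∀ i, Continuous (f i)) (hf : ∀ i x, idx x ≠ i → f i x = x) :
    Continuous fun x => f (idx x) x := by
  refine hidx.continuous ?_ (fun _ => isClosed_closure) fun i => ?_
  · exact Set.eq_univ_of_forall fun x => Set.mem_iUnion.2 ⟨idx x, subset_closure rfl⟩
  · refine (hc i).continuousOn.congr fun x hx => ?_
    show f (idx x) x = f i x
    by_cases hix : idx x = i
    · rw [hix]
    · rw [hf i x hix]
      have hcl : IsClosed {y | f (idx x) y = y} := isClosed_eq (hc _) continuous_id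
      refine closure_minimal (fun y hy => ?_) hcl hx
      refine hf _ _ ?_
      rw [show idx y = i from hy]
      exact fun h => hix h.symm

/-- Homeomorphisms supported on the pieces of a locally finite partition can be glued. -/
theorem Homeomorph.exists_glue [T2Space X] {idx : X → ι}
    (hidx : LocallyFinite fun i => closure (idx ⁻¹' {i})) {f : ι → X ≃ₜ X}
    (hf : ∀ i x, idx x ≠ i → f i x = x) :
    ∃ g : X ≃ₜ X, ∀ x, g x = f (idx x) x := by
  have hf' : ∀ i x, idx x ≠ i → (f i).symm x = x := fun i x h => by
    rw [Homeomorph.symm_apply_eq, hf i x h]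
  refine ⟨⟨⟨fun x => f (idx x) x, fun x => (f (idx x)).symm x, fun x => ?_, fun x => ?_⟩, ?_, ?_⟩,
    fun _ => rfl⟩
  · simp only [level_of_support hf, Homeomorph.symm_apply_apply]
  · have := level_of_support (f := fun i => (f i).symm) hf' x
    simp only [this, Homeomorph.apply_symm_apply]
  · exact continuous_glue hidx (fun i => (f i).continuous) hf
  · exact continuous_glue hidx (fun i => (f i).symm.continuous) hf'

end Glue

section Supported

variable {X : Type*} [TopologicalSpace X]

/-- The group of homeomorphisms which are the identity outside `U`. -/
def supportedIn (U : Set X) : Subgroup (X ≃ₜ X) where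
  carrier := {f | ∀ x, x ∉ U → f x = x}
  mul_mem' {f g} hf hg x hx := by rw [Homeomorph.group_mul_apply, hg x hx, hf x hx]
  one_mem' _ _ := rfl
  inv_mem' {f} hf x hx := by
    show f⁻¹ x = x
    rw [Homeomorph.group_inv_apply_eq_iff, hf x hx]

theorem supportedIn_mono {U V : Set X} (h : U ⊆ V) : supportedIn U ≤ supportedIn V :=
  fun _ hf x hx => hf x fun hU => hx (h hU)

theorem apply_mem_of_supportedIn {U : Set X} {f : X ≃ₜ X} (hf : f ∈ supportedIn U) {x : X}
    (hx : x ∈ U) : f x ∈ U := by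
  by_contra h
  have := f.injective (hf _ h)
  rw [this] at h
  exact h hx

theorem conj_mem_supportedIn {U V : Set X} {f : X ≃ₜ X} (hf : f ∈ supportedIn U) (c : X ≃ₜ X)
    (hc : ∀ x ∈ U, c x ∈ V) : c * f * c⁻¹ ∈ supportedIn V := by
  intro x hx
  rw [Homeomorph.group_mul_apply, Homeomorph.group_mul_apply, hf, Homeomorph.group_apply_inv_self]
  intro h
  have := hc _ h
  rw [Homeomorph.group_apply_inv_self] at this
  exact hx this

theorem commute_of_disjoint_support {U V : Set X} (hUV : Disjoint U V) {f g : X ≃ₜ X}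
    (hf : f ∈ supportedIn U) (hg : g ∈ supportedIn V) : f * g = g * f := by
  ext x
  simp only [Homeomorph.group_mul_apply]
  by_cases hx : x ∈ U
  · rw [hg x (Set.disjoint_left.1 hUV hx),
      hg _ (Set.disjoint_left.1 hUV (apply_mem_of_supportedIn hf hx))]
  · by_cases hx' : x ∈ V
    · rw [hf x hx, hf _ (Set.disjoint_right.1 hUV (apply_mem_of_supportedIn hg hx'))]
    · rw [hf x hx, hg x hx', hf x hx]

theorem WordDistorted.supportedIn_of_mapsTo {U V : Set X}
    (h : WordDistorted (supportedIn V : Set (X ≃ₜ X))) (c : X ≃ₜ X) (hc : ∀ x ∈ U, c x ∈ V) :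
    WordDistorted (supportedIn U : Set (X ≃ₜ X)) :=
  (h.conj c⁻¹).mono fun f hf => by
    show c⁻¹⁻¹ * f * c⁻¹ ∈ supportedIn V
    rw [inv_inv]
    exact conj_mem_supportedIn hf c hc

end Supported

section Strip

open Complex

/-- Vertical translation of the plane. -/
noncomputable def vertTranslation (t : ℝ) : ℂ ≃ₜ ℂ := Homeomorph.addRight (t * I)

theorem vertTranslation_apply (t : ℝ) (z : ℂ) : vertTranslation t z = z + t * I := rfl

theorem vertTranslation_inv (t : ℝ) : (vertTranslation t)⁻¹ = vertTranslation (-t) := by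
  ext z
  rw [Homeomorph.group_inv_apply_eq_iff]
  simp [vertTranslation_apply]

theorem vertTranslation_pow (n : ℕ) : vertTranslation 1 ^ n = vertTranslation n := by
  induction n with
  | zero => ext z; simp [vertTranslation_apply]
  | succ n ih =>
    ext z
    rw [pow_succ, ih, Homeomorph.group_mul_apply]
    simp [vertTranslation_apply]
    ring

theorem locallyFinite_floor_im :
    LocallyFinite fun i : ℤ => closure ((fun z : ℂ => ⌊z.im⌋) ⁻¹' {i}) := by
  have h : LocallyFinite fun i : ℤ => Complex.im ⁻¹' Set.Icc (i : ℝ) (i + 1) := by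
    have h1 : LocallyFinite fun i : ℤ => Set.Icc (i : ℝ) (i + 1) := by
      intro x
      refine ⟨Set.Ioo (x - 1) (x + 1), Ioo_mem_nhds (by linarith) (by linarith),
        (Set.finite_Icc (⌊x⌋ - 2) (⌊x⌋ + 2)).subset ?_⟩
      rintro i ⟨y, ⟨hy1, hy2⟩, hy3, hy4⟩
      have h1 := Int.floor_le x
      have h2 := Int.lt_floor_add_one x
      refine ⟨?_, ?_⟩
      · have : ((⌊x⌋ - 2 : ℤ) : ℝ) ≤ i := by push_cast; linarith
        exact_mod_cast this
      · have : (i : ℝ) < ((⌊x⌋ + 2 : ℤ) : ℝ) := by push_cast; linarith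
        exact (by exact_mod_cast this : i < ⌊x⌋ + 2).le
    exact h1.preimage_continuous continuous_im
  refine h.subset fun i => closure_minimal ?_ (isClosed_Icc.preimage continuous_im)
  rintro z hz
  have hz' : ⌊z.im⌋ = i := hz
  rw [← hz']
  exact ⟨Int.floor_le _, (Int.lt_floor_add_one _).le⟩

/-- Gluing vertical translates of homeomorphisms supported in a strip. -/
theorem exists_glue_vertTranslation (f : ℤ → ℂ ≃ₜ ℂ)
    (hf : ∀ i, f i ∈ supportedIn {z : ℂ | 0 < z.im ∧ z.im < 1}) :
    ∃ g : ℂ ≃ₜ ℂ, ∀ z : ℂ, g z = f ⌊z.im⌋ (z - ⌊z.im⌋ * I) + ⌊z.im⌋ * I := by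
  obtain ⟨g, hg⟩ := Homeomorph.exists_glue locallyFinite_floor_im
    (f := fun i => vertTranslation i * f i * (vertTranslation i)⁻¹) fun i x hx => by
      refine conj_mem_supportedIn (V := {z : ℂ | ⌊z.im⌋ = i}) (hf i) _ ?_ x (by simpa using hx)
      rintro z ⟨h1, h2⟩
      simp only [vertTranslation_apply, Set.mem_ofPred_eq, Int.floor_eq_iff, add_im, mul_im,
        ofReal_re, I_im, ofReal_im, I_re]
      constructor <;> linarith
  refine ⟨g, fun z => ?_⟩
  rw [hg]
  simp [vertTranslation_inv, vertTranslation_apply, sub_eq_add_neg]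

/-- A homeomorphism fixing the lower half plane and translating `{z | 1 ≤ im z}` up by one. -/
noncomputable def halfShift : ℂ ≃ₜ ℂ where
  toFun z := z + ((max 0 (min z.im 1) : ℝ) : ℂ) * I
  invFun z := z - ((max 0 (min (z.im / 2) 1) : ℝ) : ℂ) * I
  left_inv z := by
    apply Complex.ext
    · simp
    · simp only [sub_im, add_im, mul_im, ofReal_re, I_im, ofReal_im, I_re]
      simp only [max_def, min_def]
      split_ifs <;> linarith
  right_inv z := by
    apply Complex.ext
    · simp
    · simp only [sub_im, add_im, mul_im, ofReal_re, I_im, ofReal_im, I_re]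
      simp only [max_def, min_def]
      split_ifs <;> linarith
  continuous_toFun := by fun_prop
  continuous_invFun := by fun_prop

theorem halfShift_of_one_le {z : ℂ} (hz : 1 ≤ z.im) : halfShift z = z + I := by
  show z + ((max 0 (min z.im 1) : ℝ) : ℂ) * I = z + I
  simp [hz]

theorem halfShift_of_im_nonpos {z : ℂ} (hz : z.im ≤ 0) : halfShift z = z := by
  show z + ((max 0 (min z.im 1) : ℝ) : ℂ) * I = z
  rw [min_eq_left (by linarith), max_eq_left hz]
  simp

theorem halfShift_inv_of_two_le {z : ℂ} (hz : 2 ≤ z.im) : halfShift⁻¹ z = z - I := by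
  rw [Homeomorph.group_inv_apply_eq_iff, halfShift_of_one_le] <;> simp
  linarith

theorem halfShift_inv_im_lt {z : ℂ} (hz : z.im < 2) : (halfShift⁻¹ z).im < 1 := by
  show (z - ((max 0 (min (z.im / 2) 1) : ℝ) : ℂ) * I).im < 1
  simp only [sub_im, mul_im, ofReal_re, I_im, ofReal_im, I_re]
  simp only [max_def, min_def]
  split_ifs <;> linarith

theorem re_add_mul_I (a b : ℝ) : ((a : ℂ) + b * I).re = a := by simp

theorem im_add_mul_I (a b : ℝ) : ((a : ℂ) + b * I).im = b := by simp

/-- A homeomorphism of the plane squeezing the right half plane into a horizontal strip. -/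
noncomputable def squeezeRight : ℂ ≃ₜ ℂ where
  toFun z := ((z.re + |z.im| : ℝ) : ℂ) + ((z.im / (1 + |z.re + (|z.im|)|) / 2 + 1 / 2 : ℝ) : ℂ) * I
  invFun w :=
    ((w.re - |(2 * w.im - 1) * (1 + |w.re|)| : ℝ) : ℂ) + (((2 * w.im - 1) * (1 + |w.re|) : ℝ) : ℂ) * I
  left_inv z := by
    have h : (0 : ℝ) < 1 + |z.re + (|z.im|)| := by positivity
    have h2 : (2 * (z.im / (1 + |z.re + (|z.im|)|) / 2 + 1 / 2) - 1) * (1 + |z.re + (|z.im|)|)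
        = z.im := by field_simp; ring
    apply Complex.ext <;> simp only [re_add_mul_I, im_add_mul_I, h2]
    ring
  right_inv w := by
    have h : (0 : ℝ) < 1 + |w.re| := by positivity
    apply Complex.ext <;> simp only [re_add_mul_I, im_add_mul_I]
    · ring
    · rw [sub_add_cancel]
      field_simp
      ring
  continuous_toFun := by
    have h : ∀ z : ℂ, 1 + |z.re + (|z.im|)| ≠ 0 := fun z => by positivity
    fun_prop (disch := exact h _)
  continuous_invFun := by fun_prop

theorem squeezeRight_mem {z : ℂ} (hz : 0 < z.re) :
    squeezeRight z ∈ {z : ℂ | 0 < z.im ∧ z.im < 1} := by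
  have him : (squeezeRight z).im = z.im / (1 + |z.re + (|z.im|)|) / 2 + 1 / 2 := by
    exact im_add_mul_I _ _
  have h : (0 : ℝ) < 1 + |z.re + (|z.im|)| := by positivity
  have h2 : |z.im / (1 + |z.re + (|z.im|)|)| < 1 := by
    rw [abs_div, abs_of_pos h, div_lt_one h]
    have := le_abs_self (z.re + |z.im|)
    linarith
  rw [abs_lt] at h2
  constructor <;> rw [him] <;> linarith [h2.1, h2.2]

/-- Multiplication by a nonzero complex number. -/
noncomputable def scaling (a : ℂ) (ha : a ≠ 0) : ℂ ≃ₜ ℂ := Homeomorph.mulLeft₀ a ha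

theorem scaling_apply (a : ℂ) (ha : a ≠ 0) (z : ℂ) : scaling a ha z = a * z := rfl

theorem exists_commutator_halfShift {f : ℂ ≃ₜ ℂ}
    (hf : f ∈ supportedIn {z : ℂ | 0 < z.im ∧ z.im < 1}) :
    ∃ H ∈ supportedIn {z : ℂ | 0 < z.im},
      H * halfShift * H⁻¹ * halfShift⁻¹ = vertTranslation 1 * f * (vertTranslation 1)⁻¹ := by
  obtain ⟨H, hH⟩ := exists_glue_vertTranslation (fun i => if 1 ≤ i then f else 1) fun i => by
    split_ifs
    exacts [hf, one_mem _]
  have hH1 : ∀ z : ℂ, z.im < 1 → H z = z := fun z hz => by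
    rw [hH, if_neg]
    · simp
    · rw [not_le, Int.floor_lt]; exact_mod_cast hz
  have hH2 : ∀ z : ℂ, 1 ≤ z.im → H z = f (z - ⌊z.im⌋ * I) + ⌊z.im⌋ * I := fun z hz => by
    rw [hH, if_pos]
    rw [Int.le_floor]; exact_mod_cast hz
  refine ⟨H, fun z hz => hH1 z (by simp only [Set.mem_ofPred_eq, not_lt] at hz; linarith), ?_⟩
  have key : H = vertTranslation 1 * f * (vertTranslation 1)⁻¹ * (halfShift * H * halfShift⁻¹) := by
    ext z
    have ht : ∀ z, (vertTranslation 1 * f * (vertTranslation 1)⁻¹) z = f (z - I) + I := fun z => by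
      simp [vertTranslation_inv, vertTranslation_apply,
        sub_eq_add_neg]
    rw [Homeomorph.group_mul_apply, ht]
    simp only [Homeomorph.group_mul_apply]
    rcases lt_or_ge z.im 2 with h | h
    · rw [hH1 _ (halfShift_inv_im_lt h), Homeomorph.group_apply_inv_self]
      rcases lt_or_ge z.im 1 with h' | h'
      · rw [hH1 z h', hf (z - I)]
        · simp
        · simp; intro; linarith
      · have : ⌊z.im⌋ = 1 := by rw [Int.floor_eq_iff]; norm_num; exact ⟨h', by linarith⟩
        rw [hH2 z h', this]; simp
    · have h1 : 1 ≤ (z - I).im := by simp; linarith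
      have h2 : (⌊(z - I).im⌋ : ℤ) = ⌊z.im⌋ - 1 := by simp
      have h3 : H (z - I) = f (z - ⌊z.im⌋ * I) + ⌊z.im⌋ * I - I := by
        rw [hH2 _ h1, h2]
        have : z - I - ((⌊z.im⌋ - 1 : ℤ) : ℂ) * I = z - ⌊z.im⌋ * I := by push_cast; ring
        rw [this]
        push_cast; ring
      have h4 : 0 ≤ (f (z - ⌊z.im⌋ * I)).im := by
        by_cases hz : (z - ⌊z.im⌋ * I) ∈ {z : ℂ | 0 < z.im ∧ z.im < 1}
        · exact (apply_mem_of_supportedIn hf hz).1.le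
        · rw [hf _ hz]
          simp
      have h5 : (2 : ℝ) ≤ ⌊z.im⌋ := by
        have : (2 : ℤ) ≤ ⌊z.im⌋ := by rw [Int.le_floor]; exact_mod_cast h
        exact_mod_cast this
      have h6 : 1 ≤ (H (z - I)).im := by
        rw [h3]; simp; linarith
      rw [halfShift_inv_of_two_le h, halfShift_of_one_le h6, h3, hH2 z (by linarith)]
      rw [hf (_ + _ - I + I - I)]
      · ring
      · intro h; have := h.2; simp at this; linarith
  calc H * halfShift * H⁻¹ * halfShift⁻¹ = H * (halfShift * H * halfShift⁻¹)⁻¹ := by group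
    _ = _ := by rw [mul_inv_eq_iff_eq_mul]; exact key

theorem wordDistorted_supportedIn_strip :
    WordDistorted (supportedIn {z : ℂ | 0 < z.im ∧ z.im < 1} : Set (ℂ ≃ₜ ℂ)) := by
  set c : ℂ ≃ₜ ℂ := squeezeRight * scaling (-I) (by simp) with hc
  have hcm : ∀ z ∈ {z : ℂ | 0 < z.im}, c z ∈ {z : ℂ | 0 < z.im ∧ z.im < 1} := fun z hz => by
    rw [hc, Homeomorph.group_mul_apply]
    exact squeezeRight_mem (by simpa [scaling_apply] using hz)
  set τ := vertTranslation 1 with hτ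
  set s := c * halfShift * c⁻¹ with hs
  have hsm : s ∈ supportedIn {z : ℂ | 0 < z.im ∧ z.im < 1} :=
    conj_mem_supportedIn (fun z hz => halfShift_of_im_nonpos (not_lt.1 hz)) c hcm
  let x : Fin 4 → FreeGroup (Fin 4) := FreeGroup.of
  let t : ℕ → FreeGroup (Fin 4) := fun n => x 0 ^ n * x 2 * (x 0 ^ n)⁻¹
  refine ⟨4, fun n => (x 0 ^ n * x 1 * x 0)⁻¹ * (x 3 * t n * (x 3)⁻¹ * (t n)⁻¹) *
    (x 0 ^ n * x 1 * x 0), fun f hf => ?_⟩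
  choose H hH hHf using fun n => exists_commutator_halfShift (hf n)
  have hHc : ∀ n, c * H n * c⁻¹ ∈ supportedIn {z : ℂ | 0 < z.im ∧ z.im < 1} := fun n =>
    conj_mem_supportedIn (hH n) c hcm
  obtain ⟨u, hu⟩ := exists_glue_vertTranslation (fun i => c * H i.toNat * c⁻¹) fun i => hHc _
  refine ⟨![τ, c, s, u], fun n => ?_⟩
  have hτn : ∀ z, (τ ^ n) z = z + n * I := fun z => by
    rw [hτ, vertTranslation_pow, vertTranslation_apply]; simp
  have hτn' : ∀ z, (τ ^ n)⁻¹ z = z - n * I := fun z => by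
    rw [Homeomorph.group_inv_apply_eq_iff, hτn]; ring
  set q := τ ^ n * (c * H n * c⁻¹) * (τ ^ n)⁻¹ with hq
  set tn := τ ^ n * s * (τ ^ n)⁻¹ with htn
  have htm : tn ∈ supportedIn {z : ℂ | ⌊z.im⌋ = n} := by
    refine conj_mem_supportedIn hsm _ ?_
    rintro z ⟨h1, h2⟩
    simp only [hτn, Set.mem_ofPred_eq, Int.floor_eq_iff]
    simp
    constructor <;> linarith
  have hr : q⁻¹ * u ∈ supportedIn {z : ℂ | ⌊z.im⌋ ≠ n} := by
    intro z hz
    simp only [Set.mem_ofPred_eq, not_not] at hz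
    rw [Homeomorph.group_mul_apply, Homeomorph.group_inv_apply_eq_iff, hu, hz, hq]
    simp only [Homeomorph.group_mul_apply, hτn', hτn]
    simp
  have hcomm := commute_of_disjoint_support
    (Set.disjoint_left.2 fun (z : ℂ) hz h => by simp_all) hr htm
  have e1 : u * tn * u⁻¹ = q * tn * q⁻¹ := by
    calc u * tn * u⁻¹ = q * ((q⁻¹ * u) * tn) * u⁻¹ := by group
      _ = q * (tn * (q⁻¹ * u)) * u⁻¹ := by rw [hcomm]
      _ = q * tn * q⁻¹ := by group
  have e2 : q * tn * q⁻¹ * tn⁻¹ =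
      τ ^ n * c * (H n * halfShift * (H n)⁻¹ * halfShift⁻¹) * (τ ^ n * c)⁻¹ := by
    rw [hq, htn, hs]; group
  rw [hHf] at e2
  simp only [map_mul, map_inv, map_pow, x, t, FreeGroup.lift_apply_of]
  show f n = (τ ^ n * c * τ)⁻¹ * (u * tn * u⁻¹ * tn⁻¹) * (τ ^ n * c * τ)
  rw [e1, e2, ← hτ]
  group

theorem wordDistorted_supportedIn_re_pos :
    WordDistorted (supportedIn {z : ℂ | 0 < z.re} : Set (ℂ ≃ₜ ℂ)) :=
  wordDistorted_supportedIn_strip.supportedIn_of_mapsTo squeezeRight fun _ hz =>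
    squeezeRight_mem hz

end Strip

section Radial

open Complex Filter Topology
open scoped NNReal

theorem exists_homeomorph_ofReal_div_norm_mul {ρ : ℂ → ℝ} (hc : Continuous ρ) (h0 : ρ 0 = 0)
    (hmono : ∀ u : ℂ, ‖u‖ = 1 → StrictMonoOn (fun t : ℝ => ρ (t * u)) (Set.Ici 0))
    (hinf : Tendsto ρ (cocompact ℂ) atTop) :
    ∃ f : ℂ ≃ₜ ℂ, ∀ z, f z = ((ρ z / ‖z‖ : ℝ) : ℂ) * z := by
  have hpolar : ∀ z : ℂ, z ≠ 0 → ‖(‖z‖ : ℂ)⁻¹ * z‖ = 1 ∧ (‖z‖ : ℂ) * ((‖z‖ : ℂ)⁻¹ * z) = z :=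
    fun z hz => by
      have : (‖z‖ : ℂ) ≠ 0 := by simpa using hz
      refine ⟨?_, by field_simp⟩
      rw [norm_mul, norm_inv, Complex.norm_real, norm_norm, inv_mul_cancel₀ (by simpa using hz)]
  have hpos : ∀ z, z ≠ 0 → 0 < ρ z := fun z hz => by
    have := hmono _ (hpolar z hz).1 (Set.self_mem_Ici) (Set.mem_Ici.2 (norm_nonneg z))
      (norm_pos_iff.2 hz)
    simpa [h0, (hpolar z hz).2] using this
  have hnn : ∀ z, 0 ≤ ρ z := fun z => by
    rcases eq_or_ne z 0 with rfl | hz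
    exacts [h0.ge, (hpos z hz).le]
  set f : ℂ → ℂ := fun z => ((ρ z / ‖z‖ : ℝ) : ℂ) * z with hf
  have hfn : ∀ z, ‖f z‖ = ρ z := fun z => by
    rcases eq_or_ne z 0 with rfl | hz
    · simp [hf, h0]
    · rw [hf]
      simp only [norm_mul, Complex.norm_real, Real.norm_eq_abs]
      rw [abs_of_nonneg (by have := hnn z; positivity), div_mul_cancel₀ _ (by simpa using hz)]
  have hfu : ∀ z, z ≠ 0 → f z = ρ z * ((‖z‖ : ℂ)⁻¹ * z) := fun z hz => by
    simp only [hf]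
    push_cast
    ring
  have hfc : Continuous f := by
    rw [continuous_iff_continuousAt]
    intro z
    rcases eq_or_ne z 0 with rfl | hz
    · have : f 0 = 0 := by simp [hf]
      rw [ContinuousAt, this, tendsto_zero_iff_norm_tendsto_zero]
      simp only [hfn]
      simpa [h0] using hc.tendsto 0
    · have : ‖z‖ ≠ 0 := by simpa using hz
      simp only [hf]
      fun_prop (disch := assumption)
  have hinj : Function.Injective f := by
    intro z z' h
    have hρ : ρ z = ρ z' := by rw [← hfn, ← hfn, h]
    rcases eq_or_ne z 0 with rfl | hz
    · by_contra hne
      have := hpos z' (Ne.symm hne)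
      rw [← hρ, h0] at this
      exact lt_irrefl _ this
    · have hz' : z' ≠ 0 := by
        rintro rfl
        have := hpos z hz
        rw [hρ, h0] at this
        exact lt_irrefl _ this
      have hu : (‖z‖ : ℂ)⁻¹ * z = (‖z'‖ : ℂ)⁻¹ * z' := by
        rw [hfu z hz, hfu z' hz', ← hρ] at h
        exact mul_left_cancel₀ (by exact_mod_cast (hpos z hz).ne') h
      have hnorm : ‖z‖ = ‖z'‖ := by
        refine (hmono _ (hpolar z hz).1).injOn (norm_nonneg z) (norm_nonneg z') ?_
        rw [(hpolar z hz).2, hu, (hpolar z' hz').2, hρ]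
      rw [← (hpolar z hz).2, hu, hnorm, (hpolar z' hz').2]
  have hsurj : Function.Surjective f := by
    intro w
    rcases eq_or_ne w 0 with rfl | hw
    · exact ⟨0, by simp [hf]⟩
    · set u := (‖w‖ : ℂ)⁻¹ * w with hu
      obtain ⟨hu1, hu2⟩ := hpolar w hw
      rw [← hu] at hu1 hu2
      have hray : Tendsto (fun t : ℝ => ρ (t * u)) atTop atTop := by
        refine hinf.comp ?_
        rw [← Metric.cobounded_eq_cocompact, ← tendsto_norm_atTop_iff_cobounded]
        simp only [norm_mul, hu1, Complex.norm_real, mul_one]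
        exact tendsto_norm_atTop_atTop
      obtain ⟨T, hT, hT0⟩ := ((hray.eventually_ge_atTop ‖w‖).and (eventually_ge_atTop 0)).exists
      have hcont : Continuous fun t : ℝ => ρ (t * u) := by fun_prop
      obtain ⟨t, ht, htw⟩ := intermediate_value_Icc hT0 hcont.continuousOn
        (show ‖w‖ ∈ Set.Icc _ _ by refine ⟨?_, hT⟩; simp [h0])
      dsimp only at htw
      have ht0 : t ≠ 0 := by
        rintro rfl
        simp [h0] at htw
        exact hw (by simpa using htw.symm)
      refine ⟨t * u, ?_⟩
      simp only [hf, htw, norm_mul, hu1, Complex.norm_real, mul_one, Real.norm_eq_abs,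
        abs_of_nonneg ht.1]
      have : (t : ℂ) ≠ 0 := by exact_mod_cast ht0
      rw [← hu2]
      simp only [norm_mul, hu1, Complex.norm_real, mul_one, norm_norm]
      push_cast
      field_simp
  have hprop : IsProperMap f := by
    rw [isProperMap_iff_tendsto_cocompact]
    refine ⟨hfc, ?_⟩
    nth_rw 2 [← Metric.cobounded_eq_cocompact]
    rw [← tendsto_norm_atTop_iff_cobounded]
    simpa only [hfn] using hinf
  exact ⟨(Equiv.ofBijective f ⟨hinj, hsurj⟩).toHomeomorphOfContinuousClosed hfc hprop.isClosedMap,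
    fun _ => rfl⟩

/-- The extension of an increasing bijection of `[0, ∞)` to a function on the real line. -/
noncomputable def radius (e : ℝ≥0 ≃o ℝ≥0) (t : ℝ) : ℝ := e t.toNNReal

theorem radius_zero (e : ℝ≥0 ≃o ℝ≥0) : radius e 0 = 0 := by
  have : e 0 = 0 := e.map_bot
  simp [radius, this]

theorem radius_nonneg (e : ℝ≥0 ≃o ℝ≥0) (t : ℝ) : 0 ≤ radius e t := NNReal.coe_nonneg _

theorem continuous_radius (e : ℝ≥0 ≃o ℝ≥0) : Continuous (radius e) :=
  NNReal.continuous_coe.comp (e.continuous.comp continuous_real_toNNReal)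

theorem radius_strictMonoOn (e : ℝ≥0 ≃o ℝ≥0) : StrictMonoOn (radius e) (Set.Ici 0) := by
  intro s hs t _ hst
  exact NNReal.coe_lt_coe.2 (e.strictMono ((Real.toNNReal_lt_toNNReal_iff_of_nonneg hs).2 hst))

theorem tendsto_radius (e : ℝ≥0 ≃o ℝ≥0) : Tendsto (radius e) atTop atTop :=
  NNReal.tendsto_coe_atTop.2 (e.tendsto_atTop.comp Real.tendsto_toNNReal_atTop)

theorem exists_radial (e : ℝ≥0 ≃o ℝ≥0) :
    ∃ f : ℂ ≃ₜ ℂ, ∀ z, f z = ((radius e ‖z‖ / ‖z‖ : ℝ) : ℂ) * z := by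
  refine exists_homeomorph_ofReal_div_norm_mul (ρ := fun z => radius e ‖z‖)
    ((continuous_radius e).comp continuous_norm) (by simp [radius_zero]) (fun u hu s hs t ht hst => ?_)
    ((tendsto_radius e).comp (tendsto_norm_cocompact_atTop (E := ℂ)))
  simp only [norm_mul, hu, mul_one, Complex.norm_real, Real.norm_eq_abs]
  rw [abs_of_nonneg hs, abs_of_nonneg ht]
  exact radius_strictMonoOn e hs ht hst

/-- The radial homeomorphism of the plane acting by `e` on norms. -/
noncomputable def radial (e : ℝ≥0 ≃o ℝ≥0) : ℂ ≃ₜ ℂ := (exists_radial e).choose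

theorem radial_apply (e : ℝ≥0 ≃o ℝ≥0) (z : ℂ) :
    radial e z = ((radius e ‖z‖ / ‖z‖ : ℝ) : ℂ) * z := (exists_radial e).choose_spec z

theorem norm_radial (e : ℝ≥0 ≃o ℝ≥0) (z : ℂ) : ‖radial e z‖ = radius e ‖z‖ := by
  rw [radial_apply]
  rcases eq_or_ne z 0 with rfl | hz
  · simp [radius_zero]
  · rw [norm_mul, Complex.norm_real, Real.norm_eq_abs, abs_of_nonneg
      (div_nonneg (radius_nonneg _ _) (norm_nonneg _)), div_mul_cancel₀ _ (by simpa using hz)]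

theorem exists_partial_radial (e : ℝ≥0 ≃o ℝ≥0) :
    ∃ f ∈ supportedIn {z : ℂ | 0 < z.re}, ∀ z : ℂ, |z.im| ≤ z.re → f z = radial e z := by
  set w : ℂ → ℝ := fun z => min 1 (2 * max 0 z.re / ‖z‖) with hw
  have hw0 : ∀ z, 0 ≤ w z := fun z => le_min zero_le_one (by positivity)
  have hw1 : ∀ z, w z ≤ 1 := fun z => min_le_left _ _
  set ρ : ℂ → ℝ := fun z => (1 - w z) * ‖z‖ + w z * radius e ‖z‖ with hρ
  have hρ0 : ρ 0 = 0 := by simp [hρ, radius_zero]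
  have hrc := continuous_radius e
  have hbd : ∀ z, 0 ≤ ρ z ∧ ρ z ≤ ‖z‖ + radius e ‖z‖ := fun z => by
    have h1 := hw0 z
    have h2 := hw1 z
    have h3 := norm_nonneg z
    have h4 := radius_nonneg e ‖z‖
    constructor <;> simp only [hρ] <;> nlinarith
  have hex : ∃ f : ℂ ≃ₜ ℂ, ∀ z, f z = ((ρ z / ‖z‖ : ℝ) : ℂ) * z := by
    refine exists_homeomorph_ofReal_div_norm_mul ?_ hρ0 ?_ ?_
    · rw [continuous_iff_continuousAt]
      intro z
      rcases eq_or_ne z 0 with rfl | hz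
      · rw [ContinuousAt, hρ0]
        refine squeeze_zero (fun z => (hbd z).1) (fun z => (hbd z).2) ?_
        have : Continuous fun z : ℂ => ‖z‖ + radius e ‖z‖ := by fun_prop
        simpa [radius_zero] using this.tendsto 0
      · have : ‖z‖ ≠ 0 := by simpa using hz
        simp only [hρ, hw]
        fun_prop (disch := assumption)
    · intro u hu
      have key : ∀ t : ℝ, 0 ≤ t → ρ (t * u) = (1 - w u) * t + w u * radius e t := fun t ht => by
        rcases ht.eq_or_lt with rfl | ht'
        · simp [hρ0, radius_zero]
        · have h1 : w (t * u) = w u := by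
            simp only [hw, norm_mul, hu, Complex.norm_real, Real.norm_eq_abs, abs_of_pos ht',
              re_ofReal_mul]
            congr 1
            rw [← mul_zero t, ← mul_max_of_nonneg _ _ ht]
            field_simp
            simp
          simp [hρ, h1, hu, abs_of_pos ht']
      intro s hs t ht hst
      dsimp only
      rw [key s hs, key t ht]
      have h1 := radius_strictMonoOn e hs ht hst
      have h2 := hw0 u
      rcases h2.eq_or_lt with h3 | h3
      · rw [← h3]; linarith
      · nlinarith [hw1 u]
    · have h1 : Tendsto (fun z : ℂ => min ‖z‖ (radius e ‖z‖)) (cocompact ℂ) atTop := by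
        rw [tendsto_atTop]
        intro b
        filter_upwards [(tendsto_norm_cocompact_atTop (E := ℂ)).eventually_ge_atTop b,
          ((tendsto_radius e).comp (tendsto_norm_cocompact_atTop (E := ℂ))).eventually_ge_atTop b]
          with z h1 h2 using le_min h1 h2
      refine tendsto_atTop_mono (fun z => ?_) h1
      have h1 := hw0 z
      have h2 := hw1 z
      have h3 := min_le_left ‖z‖ (radius e ‖z‖)
      have h4 := min_le_right ‖z‖ (radius e ‖z‖)
      simp only [hρ]
      nlinarith
  obtain ⟨f, hf⟩ := hex
  refine ⟨f, fun z hz => ?_, fun z hz => ?_⟩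
  · simp only [Set.mem_ofPred_eq, not_lt] at hz
    have : w z = 0 := by simp [hw, hz]
    rw [hf]
    rcases eq_or_ne z 0 with rfl | hz
    · simp
    · have : ‖z‖ ≠ 0 := by simpa using hz
      simp [*]
  · rw [hf, radial_apply]
    rcases eq_or_ne z 0 with rfl | hz0
    · simp
    · have h1 : w z = 1 := by
        simp only [hw]
        refine min_eq_left ?_
        rw [one_le_div (norm_pos_iff.2 hz0)]
        have h2 := Complex.norm_le_abs_re_add_abs_im z
        have h3 : 0 ≤ z.re := (abs_nonneg _).trans hz
        rw [abs_of_nonneg h3] at h2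
        have := le_max_right 0 z.re
        linarith
      simp [hρ, h1]

/-- An involution of the plane exchanging a right-angled sector with its complement. -/
noncomputable def sectorFlip : ℂ ≃ₜ ℂ where
  toFun z := ((|z.im| - z.re : ℝ) : ℂ) + (z.im : ℝ) * I
  invFun z := ((|z.im| - z.re : ℝ) : ℂ) + (z.im : ℝ) * I
  left_inv z := by apply Complex.ext <;> simp only [re_add_mul_I, im_add_mul_I]; ring
  right_inv z := by apply Complex.ext <;> simp only [re_add_mul_I, im_add_mul_I]; ring
  continuous_toFun := by fun_prop
  continuous_invFun := by fun_prop

theorem wordDistorted_range_radial : WordDistorted (Set.range radial) := by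
  have h : WordDistorted (supportedIn {z : ℂ | z.re < |z.im|} : Set (ℂ ≃ₜ ℂ)) := by
    refine wordDistorted_supportedIn_re_pos.supportedIn_of_mapsTo sectorFlip fun z hz => ?_
    show 0 < (((|z.im| - z.re : ℝ) : ℂ) + (z.im : ℝ) * I).re
    rw [re_add_mul_I]
    exact sub_pos.2 hz
  refine (wordDistorted_supportedIn_re_pos.mul h).mono ?_
  rintro _ ⟨e, rfl⟩
  obtain ⟨f, hf, hfe⟩ := exists_partial_radial e
  refine ⟨f, hf, f⁻¹ * radial e, fun z hz => ?_, by group⟩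
  rw [Homeomorph.group_mul_apply, Homeomorph.group_inv_apply_eq_iff, hfe]
  simpa using hz

end Radial

section PiecewiseLinear

open Filter
open scoped NNReal

theorem radius_trans (e e' : ℝ≥0 ≃o ℝ≥0) (t : ℝ) :
    radius (e.trans e') t = radius e' (radius e t) := by
  simp [radius]

theorem radius_symm (e : ℝ≥0 ≃o ℝ≥0) {t : ℝ} (ht : 0 ≤ t) :
    radius e.symm (radius e t) = t := by
  simp [radius, ht]

theorem radius_symm' (e : ℝ≥0 ≃o ℝ≥0) {t : ℝ} (ht : 0 ≤ t) :
    radius e (radius e.symm t) = t := by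
  simp [radius, ht]

theorem exists_radius_interpolating {b : ℕ → ℝ} (hb : StrictMono b) (hb0 : b 0 = 0)
    (hbt : Tendsto b atTop atTop) :
    ∃ e : ℝ≥0 ≃o ℝ≥0, ∀ (i : ℕ) (s : ℝ), 0 ≤ s → s ≤ 1 →
      radius e (i + s) = b i + s * (b (i + 1) - b i) := by
  have hpos : ∀ i, 0 < b (i + 1) - b i := fun i => sub_pos.2 (hb (Nat.lt_succ_self i))
  have hbn : ∀ i, 0 ≤ b i := fun i => hb0 ▸ hb.monotone (Nat.zero_le i)
  set p : ℝ → ℝ := fun t => b ⌊t⌋₊ + (t - ⌊t⌋₊) * (b (⌊t⌋₊ + 1) - b ⌊t⌋₊) with hp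
  have hp0 : ∀ t, 0 ≤ t → b ⌊t⌋₊ ≤ p t := fun t ht => by
    have := Nat.floor_le ht
    have := mul_nonneg (sub_nonneg.2 this) (hpos ⌊t⌋₊).le
    simp only [hp]; linarith
  have hp1 : ∀ t, 0 ≤ t → p t < b (⌊t⌋₊ + 1) := fun t ht => by
    have := Nat.lt_floor_add_one t
    have := hpos ⌊t⌋₊
    simp only [hp]; nlinarith
  have hadd : ∀ (i : ℕ) (s : ℝ), 0 ≤ s → s < 1 → p (i + s) = b i + s * (b (i + 1) - b i) := by
    intro i s h0 h1
    have : ⌊(i : ℝ) + s⌋₊ = i := by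
      rw [Nat.floor_eq_iff (by positivity)]
      constructor <;> linarith
    simp only [hp, this, add_sub_cancel_left]
  have hmono : ∀ s t, 0 ≤ s → s < t → p s < p t := by
    intro s t hs hst
    have ht := hs.trans hst.le
    rcases (Nat.floor_mono hst.le).eq_or_lt with h | h
    · simp only [hp, h]
      have := mul_lt_mul_of_pos_right (sub_lt_sub_right hst (⌊t⌋₊ : ℝ)) (hpos ⌊t⌋₊)
      linarith
    · exact ((hp1 s hs).trans_le (hb.monotone (Nat.succ_le_of_lt h))).trans_le (hp0 t ht)
  have hsurj : ∀ y, 0 ≤ y → ∃ t, 0 ≤ t ∧ p t = y := by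
    intro y hy
    have hex : ∃ i, y < b (i + 1) :=
      ((tendsto_add_atTop_iff_nat 1).2 hbt |>.eventually_gt_atTop y).exists
    classical
    set i := Nat.find hex with hi
    have h1 : y < b (i + 1) := Nat.find_spec hex
    have h2 : b i ≤ y := by
      rcases Nat.eq_zero_or_pos i with h | h
      · rw [h, hb0]; exact hy
      · have := Nat.find_min hex (m := i - 1) (by omega)
        rw [Nat.sub_add_cancel h] at this
        exact not_lt.1 this
    have h3 := hpos i
    refine ⟨i + (y - b i) / (b (i + 1) - b i), by
      have := div_nonneg (sub_nonneg.2 h2) h3.le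
      positivity, ?_⟩
    rw [hadd i _ (div_nonneg (sub_nonneg.2 h2) h3.le) (by rw [div_lt_one h3]; linarith)]
    field_simp
    ring
  have hpn : ∀ t : ℝ≥0, 0 ≤ p t := fun t => (hbn _).trans (hp0 t t.2)
  let q : ℝ≥0 → ℝ≥0 := fun t => ⟨p t, hpn t⟩
  have hq : StrictMono q := fun s t hst => NNReal.coe_lt_coe.1 (hmono s t s.2 hst)
  have hqs : Function.Surjective q := fun y => by
    obtain ⟨t, ht, hty⟩ := hsurj y y.2
    exact ⟨⟨t, ht⟩, NNReal.coe_injective hty⟩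
  have he : ∀ t, 0 ≤ t → radius (hq.orderIsoOfSurjective q hqs) t = p t := fun t ht => by
    show p (t.toNNReal : ℝ) = p t
    rw [Real.coe_toNNReal t ht]
  refine ⟨hq.orderIsoOfSurjective q hqs, fun i s h0 h1 => ?_⟩
  rw [he _ (by positivity)]
  rcases h1.eq_or_lt with rfl | h1
  · have := hadd (i + 1) 0 le_rfl one_pos
    push_cast at this
    rw [add_zero, zero_mul, add_zero] at this
    rw [this]; ring
  · exact hadd i s h0 h1

/-- There is a piecewise linear increasing bijection of `[0, ∞)` with prescribed nodes. -/
theorem exists_radius_piecewise {b b' : ℕ → ℝ} (hb : StrictMono b) (hb0 : b 0 = 0)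
    (hbt : Tendsto b atTop atTop) (hb' : StrictMono b') (hb0' : b' 0 = 0)
    (hbt' : Tendsto b' atTop atTop) :
    ∃ e : ℝ≥0 ≃o ℝ≥0, ∀ (i : ℕ) (s : ℝ), 0 ≤ s → s ≤ 1 →
      radius e (b i + s * (b (i + 1) - b i)) = b' i + s * (b' (i + 1) - b' i) := by
  obtain ⟨e, he⟩ := exists_radius_interpolating hb hb0 hbt
  obtain ⟨e', he'⟩ := exists_radius_interpolating hb' hb0' hbt'
  refine ⟨e.symm.trans e', fun i s h0 h1 => ?_⟩
  rw [radius_trans, ← he i s h0 h1, radius_symm e (by positivity), he' i s h0 h1]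

end PiecewiseLinear

section Annuli

open Complex Filter
open scoped NNReal

/-- Boundary radii of the annuli `32 ^ a i < ‖z‖ < 16 * 32 ^ a i`. -/
noncomputable def annulusRadii (a : ℕ → ℕ) : ℕ → ℝ
  | 0 => 0
  | n + 1 => (if n % 2 = 0 then 1 else 16) * 32 ^ a (n / 2)

theorem annulusRadii_even (a : ℕ → ℕ) (i : ℕ) : annulusRadii a (2 * i + 1) = 32 ^ a i := by
  simp [annulusRadii]

theorem annulusRadii_odd (a : ℕ → ℕ) (i : ℕ) :
    annulusRadii a (2 * i + 1 + 1) = 16 * 32 ^ a i := by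
  have h1 : (2 * i + 1) % 2 = 1 := by omega
  have h2 : (2 * i + 1) / 2 = i := by omega
  simp [annulusRadii, h1, h2]

theorem annulusRadii_strictMono {a : ℕ → ℕ} (ha : StrictMono a) : StrictMono (annulusRadii a) := by
  refine strictMono_nat_of_lt_succ fun n => ?_
  rcases n with _ | n
  · simp [annulusRadii]
  · rcases Nat.even_or_odd' n with ⟨i, rfl | rfl⟩
    · rw [annulusRadii_even, annulusRadii_odd]
      have : (0 : ℝ) < 32 ^ a i := by positivity
      linarith
    · rw [annulusRadii_odd, show 2 * i + 1 + 1 + 1 = 2 * (i + 1) + 1 by ring, annulusRadii_even]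
      have h1 : (0 : ℝ) < 32 ^ a i := by positivity
      have h2 : (32 : ℝ) ^ (a i + 1) ≤ 32 ^ a (i + 1) :=
        pow_le_pow_right₀ (by norm_num) (ha (Nat.lt_succ_self i))
      rw [pow_succ] at h2
      linarith

theorem tendsto_annulusRadii {a : ℕ → ℕ} (ha : StrictMono a) :
    Tendsto (annulusRadii a) atTop atTop := by
  refine tendsto_atTop_atTop_of_monotone (annulusRadii_strictMono ha).monotone fun r => ?_
  obtain ⟨n, hn⟩ := pow_unbounded_of_one_lt r (show (1 : ℝ) < 32 by norm_num)
  refine ⟨2 * n + 1, ?_⟩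
  rw [annulusRadii_even]
  exact hn.le.trans (pow_le_pow_right₀ (by norm_num) (ha.id_le n))

theorem exists_radius_annuli {a : ℕ → ℕ} (ha : StrictMono a) :
    ∃ e : ℝ≥0 ≃o ℝ≥0, ∀ (i : ℕ) (r : ℝ), 32 ^ i ≤ r → r ≤ 16 * 32 ^ i →
      radius e r = 32 ^ a i / 32 ^ i * r := by
  obtain ⟨e, he⟩ := exists_radius_piecewise (annulusRadii_strictMono strictMono_id) rfl
    (tendsto_annulusRadii strictMono_id) (annulusRadii_strictMono ha) rfl (tendsto_annulusRadii ha)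
  refine ⟨e, fun i r h1 h2 => ?_⟩
  have hp : (0 : ℝ) < 32 ^ i := by positivity
  have := he (2 * i + 1) ((r - 32 ^ i) / (15 * 32 ^ i)) (div_nonneg (by linarith) (by positivity))
    (by rw [div_le_one (by positivity)]; linarith)
  rw [annulusRadii_even, annulusRadii_even, annulusRadii_odd, annulusRadii_odd] at this
  simp only [id] at this
  convert this using 1
  · congr 1
    field_simp
    ring
  · field_simp
    ring

/-- A radial homeomorphism mapping the `i`-th annulus linearly onto the `a i`-th one. -/
noncomputable def annulusShift (a : ℕ → ℕ) (ha : StrictMono a) : ℂ ≃ₜ ℂ :=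
  radial (exists_radius_annuli ha).choose

/-- The open annulus `32 ^ l < ‖z‖ < 16 * 32 ^ l`. -/
def annulus (l : ℕ) : Set ℂ := {z | 32 ^ l < ‖z‖ ∧ ‖z‖ < 16 * 32 ^ l}

theorem mem_annulus {l : ℕ} {z : ℂ} : z ∈ annulus l ↔ 32 ^ l < ‖z‖ ∧ ‖z‖ < 16 * 32 ^ l := Iff.rfl

theorem annulusShift_apply {a : ℕ → ℕ} (ha : StrictMono a) {l : ℕ} {z : ℂ} (hz : z ∈ annulus l) :
    annulusShift a ha z = 32 ^ a l / 32 ^ l * z := by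
  have hz0 : ‖z‖ ≠ 0 := (lt_trans (by positivity) hz.1).ne'
  rw [annulusShift, radial_apply, (exists_radius_annuli ha).choose_spec l _ hz.1.le hz.2.le,
    mul_div_assoc, div_self hz0]
  push_cast
  ring

theorem annulusShift_mem_iff {a : ℕ → ℕ} (ha : StrictMono a) {l : ℕ} {z : ℂ} :
    annulusShift a ha z ∈ annulus (a l) ↔ z ∈ annulus l := by
  have h := (exists_radius_annuli ha).choose_spec l
  have hp : (0 : ℝ) < 32 ^ l := by positivity
  have h1 := h (32 ^ l) le_rfl (by linarith)
  have h2 := h (16 * 32 ^ l) (by linarith) le_rfl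
  have hm := radius_strictMonoOn (exists_radius_annuli ha).choose
  rw [mem_annulus, mem_annulus, annulusShift, norm_radial,
    ← hm.lt_iff_lt (Set.mem_Ici.2 hp.le) (Set.mem_Ici.2 (norm_nonneg z)),
    ← hm.lt_iff_lt (Set.mem_Ici.2 (norm_nonneg z)) (Set.mem_Ici.2 (by positivity)), h1, h2,
    show (32 : ℝ) ^ a l / 32 ^ l * 32 ^ l = 32 ^ a l by field_simp,
    show (32 : ℝ) ^ a l / 32 ^ l * (16 * 32 ^ l) = 16 * 32 ^ a l by field_simp]

/-- The index of the dyadic-like shell `32 ^ l ≤ ‖z‖ < 32 ^ (l + 1)` containing `z`. -/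
noncomputable def shell (z : ℂ) : ℕ := Nat.log 32 ⌊‖z‖⌋₊

theorem shell_eq {l : ℕ} {z : ℂ} (h1 : 32 ^ l ≤ ‖z‖) (h2 : ‖z‖ < 32 ^ (l + 1)) : shell z = l := by
  refine Nat.log_eq_of_pow_le_of_lt_pow ?_ ?_
  · rw [Nat.le_floor_iff (norm_nonneg z)]; exact_mod_cast h1
  · rw [Nat.floor_lt (norm_nonneg z)]; exact_mod_cast h2

theorem shell_of_mem {l : ℕ} {z : ℂ} (h : z ∈ annulus l) : shell z = l := by
  refine shell_eq h.1.le (h.2.trans ?_)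
  have : (0 : ℝ) < 32 ^ l := by positivity
  rw [pow_succ]; linarith

theorem locallyFinite_shell : LocallyFinite fun i : ℕ => closure (shell ⁻¹' {i}) := by
  intro z
  obtain ⟨N, hN⟩ := exists_nat_gt ‖z‖
  have ho : IsOpen {y : ℂ | ‖y‖ < N} := isOpen_lt continuous_norm continuous_const
  refine ⟨{y | ‖y‖ < N}, ho.mem_nhds hN, (Set.finite_Iic (Nat.log 32 N)).subset ?_⟩
  rintro i hi
  have hi' : (closure (shell ⁻¹' {i}) ∩ {y : ℂ | ‖y‖ < N}).Nonempty := hi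
  obtain ⟨y, hy, hyN⟩ := (closure_inter_open_nonempty_iff ho).1 hi'
  rw [← show shell y = i from hy]
  exact Nat.log_mono_right (Nat.floor_le_of_le (le_of_lt hyN))

theorem scaling_conj_mem {f : ℂ ≃ₜ ℂ} (hf : f ∈ supportedIn (annulus 0)) (l : ℕ) :
    scaling (32 ^ l) (by simp) * f * (scaling (32 ^ l) (by simp))⁻¹ ∈ supportedIn (annulus l) := by
  refine conj_mem_supportedIn hf _ fun z hz => ?_
  rw [mem_annulus] at hz ⊢
  have hp : (0 : ℝ) < 32 ^ l := by positivity
  rw [scaling_apply, norm_mul, norm_pow, Complex.norm_ofNat]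
  constructor <;> nlinarith [hz.1, hz.2]

theorem scaling_inv_apply (a : ℂ) (ha : a ≠ 0) (z : ℂ) : (scaling a ha)⁻¹ z = z / a := by
  rw [Homeomorph.group_inv_apply_eq_iff, scaling_apply]
  field_simp

theorem exists_glue_annuli (X : ℕ → supportedIn (annulus 0)) :
    ∃ g : ℂ ≃ₜ ℂ, ∀ z : ℂ,
      g z = 32 ^ shell z * (X (shell z) : ℂ ≃ₜ ℂ) (z / 32 ^ shell z) := by
  obtain ⟨g, hg⟩ := Homeomorph.exists_glue locallyFinite_shell
    (f := fun l => scaling (32 ^ l) (by simp) * X l * (scaling (32 ^ l) (by simp))⁻¹)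
    fun l z hz => scaling_conj_mem (X l).2 l z fun h => hz (shell_of_mem h)
  refine ⟨g, fun z => ?_⟩
  rw [hg, Homeomorph.group_mul_apply, Homeomorph.group_mul_apply, scaling_inv_apply, scaling_apply]

theorem div_mem_annulus_zero {l : ℕ} {z : ℂ} : z / 32 ^ l ∈ annulus 0 ↔ z ∈ annulus l := by
  have hp : (0 : ℝ) < 32 ^ l := by positivity
  simp only [mem_annulus, norm_div, norm_pow, Complex.norm_ofNat, lt_div_iff₀ hp, div_lt_iff₀ hp]
  simp

theorem exists_glue_annuli' (X : ℕ → supportedIn (annulus 0)) :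
    ∃ g : ℂ ≃ₜ ℂ, (∀ l, ∀ z ∈ annulus l, g z = 32 ^ l * (X l : ℂ ≃ₜ ℂ) (z / 32 ^ l)) ∧
      ∀ z, (∀ l, z ∈ annulus l → X l = 1) → g z = z := by
  obtain ⟨g, hg⟩ := exists_glue_annuli X
  refine ⟨g, fun l z hz => by rw [hg, shell_of_mem hz], fun z hz => ?_⟩
  rw [hg]
  by_cases h : z ∈ annulus (shell z)
  · rw [hz _ h, Subgroup.coe_one, Homeomorph.group_one_apply]
    field_simp
  · rw [(X (shell z)).2 _ (fun h' => h (div_mem_annulus_zero.1 h'))]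
    field_simp

/-- Spread a sequence of homeomorphisms supported in an annulus over rescaled annuli. -/
noncomputable def annuliGlue : (ℕ → supportedIn (annulus 0)) →* (ℂ ≃ₜ ℂ) :=
  MonoidHom.mk' (fun X => (exists_glue_annuli' X).choose) fun X Y => by
    have hX := (exists_glue_annuli' X).choose_spec
    have hY := (exists_glue_annuli' Y).choose_spec
    have hXY := (exists_glue_annuli' (X * Y)).choose_spec
    set gX := (exists_glue_annuli' X).choose
    set gY := (exists_glue_annuli' Y).choose
    set gXY := (exists_glue_annuli' (X * Y)).choose
    ext z
    rw [Homeomorph.group_mul_apply]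
    by_cases h : ∃ l, z ∈ annulus l
    · obtain ⟨l, hl⟩ := h
      have h1 := div_mem_annulus_zero.2 hl
      have h2 := apply_mem_of_supportedIn (Y l).2 h1
      have h3 : (32 ^ l * (Y l : ℂ ≃ₜ ℂ) (z / 32 ^ l)) / 32 ^ l = (Y l : ℂ ≃ₜ ℂ) (z / 32 ^ l) := by
        field_simp
      rw [hXY.1 l z hl, hY.1 l z hl, hX.1 l, h3]
      · rfl
      · rw [← div_mem_annulus_zero, h3]; exact h2
    · rw [hY.2 z fun l hl => (h ⟨l, hl⟩).elim, hX.2 z fun l hl => (h ⟨l, hl⟩).elim,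
        hXY.2 z fun l hl => (h ⟨l, hl⟩).elim]

theorem annuliGlue_apply (X : ℕ → supportedIn (annulus 0)) {l : ℕ} {z : ℂ} (hz : z ∈ annulus l) :
    annuliGlue X z = 32 ^ l * (X l : ℂ ≃ₜ ℂ) (z / 32 ^ l) :=
  (exists_glue_annuli' X).choose_spec.1 l z hz

theorem annuliGlue_apply_of_eq_one (X : ℕ → supportedIn (annulus 0)) {z : ℂ}
    (hz : ∀ l, z ∈ annulus l → X l = 1) : annuliGlue X z = z :=
  (exists_glue_annuli' X).choose_spec.2 z hz

theorem annuliGlue_mem (X : ℕ → supportedIn (annulus 0)) {l : ℕ} {z : ℂ} (hz : z ∈ annulus l) :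
    annuliGlue X z ∈ annulus l := by
  rw [annuliGlue_apply X hz, ← div_mem_annulus_zero, mul_div_cancel_left₀ _ (by simp)]
  exact apply_mem_of_supportedIn (X l).2 (div_mem_annulus_zero.2 hz)

theorem annulusShift_conj {a : ℕ → ℕ} (ha : StrictMono a) (X : ℕ → supportedIn (annulus 0)) :
    annulusShift a ha * annuliGlue X * (annulusShift a ha)⁻¹ =
      annuliGlue (Function.extend a X 1) := by
  rw [mul_inv_eq_iff_eq_mul]
  ext z
  simp only [Homeomorph.group_mul_apply]
  by_cases h : ∃ l, z ∈ annulus l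
  · obtain ⟨l, hl⟩ := h
    rw [annuliGlue_apply _ ((annulusShift_mem_iff ha).2 hl),
      annulusShift_apply ha (annuliGlue_mem X hl), annulusShift_apply ha hl,
      annuliGlue_apply X hl, ha.injective.extend_apply]
    have : (32 : ℂ) ^ a l / 32 ^ l * z / 32 ^ a l = z / 32 ^ l := by field_simp
    rw [this]
    field_simp
  · rw [annuliGlue_apply_of_eq_one X fun l hl => (h ⟨l, hl⟩).elim, annuliGlue_apply_of_eq_one]
    intro m hm
    refine Function.extend_apply' _ _ _ ?_
    rintro ⟨l, rfl⟩
    exact h ⟨l, (annulusShift_mem_iff ha).1 hm⟩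

end Annuli

section AnnuliDistorted

/-- Successive products `X j * ⋯ * X 0`. -/
def partialProd {G : Type*} [Group G] (X : ℕ → G) : ℕ → G
  | 0 => X 0
  | j + 1 => X (j + 1) * partialProd X j

/-- The sequence `H 0, (H 0)⁻¹, H 1, (H 1)⁻¹, …`. -/
def interlaceInv {G : Type*} [Group G] (H : ℕ → G) (i : ℕ) : G :=
  if i % 2 = 0 then H (i / 2) else (H (i / 2))⁻¹

theorem interlaceInv_even {G : Type*} [Group G] (H : ℕ → G) (i : ℕ) :
    interlaceInv H (2 * i) = H i := by
  simp [interlaceInv]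

theorem interlaceInv_odd {G : Type*} [Group G] (H : ℕ → G) (i : ℕ) :
    interlaceInv H (2 * i + 1) = (H i)⁻¹ := by
  have h1 : (2 * i + 1) % 2 = 1 := by omega
  have h2 : (2 * i + 1) / 2 = i := by omega
  simp [interlaceInv, h1, h2]

theorem extend_even {G : Type*} [Group G] (X : ℕ → G) (p : ℕ) :
    Function.extend (fun i => 2 * i) X 1 (2 * p) = X p :=
  (show Function.Injective fun i : ℕ => 2 * i from fun i j h => by simpa using h).extend_apply X 1 p

theorem extend_even_odd {G : Type*} [Group G] (X : ℕ → G) (p : ℕ) :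
    Function.extend (fun i : ℕ => 2 * i) X 1 (2 * p + 1) = 1 :=
  Function.extend_apply' X (1 : ℕ → G) _ (by rintro ⟨i, hi⟩; omega)

theorem interlaceInv_mul_extend_succ {G : Type*} [Group G] (X : ℕ → G) :
    interlaceInv (partialProd X) * Function.extend Nat.succ (interlaceInv (partialProd X)) 1 =
      Function.extend (fun i => 2 * i) X 1 := by
  have hs : ∀ Z : ℕ → G, ∀ i, Function.extend Nat.succ Z 1 (i + 1) = Z i := fun Z i =>
    Nat.succ_injective.extend_apply Z 1 i
  funext i
  rw [Pi.mul_apply]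
  rcases Nat.even_or_odd' i with ⟨p, rfl | rfl⟩
  · rw [interlaceInv_even, extend_even]
    rcases p with _ | p
    · rw [mul_zero, Function.extend_apply' _ _ _ (by rintro ⟨i, hi⟩; exact Nat.succ_ne_zero i hi)]
      simp [partialProd]
    · rw [show 2 * (p + 1) = 2 * p + 1 + 1 by ring, hs, interlaceInv_odd]
      simp [partialProd]
  · rw [interlaceInv_odd, extend_even_odd, hs, interlaceInv_even, inv_mul_cancel]

/-- Positions selecting the `n`-th row in a doubled enumeration of `ℕ × ℕ`. -/
def selectPos (n p : ℕ) : ℕ := 2 * p + if (Nat.unpair p).1 = n then 1 else 0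

theorem selectPos_strictMono (n : ℕ) : StrictMono (selectPos n) := by
  refine strictMono_nat_of_lt_succ fun p => ?_
  unfold selectPos
  split_ifs <;> omega

/-- Positions occupied by the `n`-th row in a doubled enumeration of `ℕ × ℕ`. -/
def rowPos (n i : ℕ) : ℕ := 2 * Nat.pair n (i / 2) + i % 2

theorem rowPos_strictMono (n : ℕ) : StrictMono (rowPos n) := by
  refine strictMono_nat_of_lt_succ fun i => ?_
  unfold rowPos
  rcases Nat.even_or_odd' i with ⟨p, rfl | rfl⟩
  · have h1 : (2 * p + 1) / 2 = p := by omega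
    have h2 : (2 * p) / 2 = p := by omega
    rw [h1, h2]; omega
  · have h1 : (2 * p + 1) / 2 = p := by omega
    have h2 : (2 * p + 1 + 1) / 2 = p + 1 := by omega
    rw [h1, h2]
    have := Nat.pair_lt_pair_right n (Nat.lt_succ_self p)
    simp only [Nat.succ_eq_add_one] at this
    omega

theorem double_strictMono : StrictMono fun i : ℕ => 2 * i := fun i j h => by
  dsimp only; omega

theorem natSucc_strictMono : StrictMono Nat.succ := fun _ _ h => Nat.succ_lt_succ h

theorem extend_double_mul_extend_selectPos {G : Type*} [Group G] (H : ℕ → ℕ → G) (n : ℕ) :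
    Function.extend (fun i => 2 * i) (fun p => H (Nat.unpair p).1 (Nat.unpair p).2) 1 *
      Function.extend (selectPos n) (fun p => (H (Nat.unpair p).1 (Nat.unpair p).2)⁻¹) 1 =
    Function.extend (rowPos n) (interlaceInv (H n)) 1 := by
  funext i
  rw [Pi.mul_apply]
  have hα : ∀ (p m : ℕ), selectPos n p = m → ∀ Z : ℕ → G,
      Function.extend (selectPos n) Z 1 m = Z p := by
    rintro p m rfl Z
    exact (selectPos_strictMono n).injective.extend_apply _ _ _
  have hα' : ∀ (m : ℕ), (∀ p, selectPos n p ≠ m) → ∀ Z : ℕ → G,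
      Function.extend (selectPos n) Z 1 m = 1 := fun m hm Z =>
    Function.extend_apply' _ _ _ (by rintro ⟨p, hp⟩; exact hm p hp)
  have hc : ∀ (p m : ℕ), rowPos n p = m → ∀ Z : ℕ → G,
      Function.extend (rowPos n) Z 1 m = Z p := by
    rintro p m rfl Z
    exact (rowPos_strictMono n).injective.extend_apply _ _ _
  have hc' : ∀ (m : ℕ), (∀ p, rowPos n p ≠ m) → ∀ Z : ℕ → G,
      Function.extend (rowPos n) Z 1 m = 1 := fun m hm Z =>
    Function.extend_apply' _ _ _ (by rintro ⟨p, hp⟩; exact hm p hp)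
  have hrow : ∀ p i : ℕ, ∀ r < 2, rowPos n i = 2 * p + r → (Nat.unpair p).1 = n := by
    intro p i r hr h
    unfold rowPos at h
    have : p = Nat.pair n (i / 2) := by omega
    rw [this, Nat.unpair_pair]
  rcases Nat.even_or_odd' i with ⟨p, rfl | rfl⟩
  · rw [extend_even]
    by_cases hp : (Nat.unpair p).1 = n
    · rw [hα' _ (fun q hq => ?_), hc (2 * (Nat.unpair p).2), interlaceInv_even, mul_one, hp]
      · simp [rowPos, ← hp]
      · unfold selectPos at hq
        split_ifs at hq with h
        · omega
        · exact h (by rw [show q = p by omega, hp])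
    · rw [hα p (2 * p) (by simp [selectPos, hp]), mul_inv_cancel,
        hc' _ fun q hq => hp (hrow p q 0 (by norm_num) (by simpa using hq))]
  · rw [extend_even_odd, one_mul]
    by_cases hp : (Nat.unpair p).1 = n
    · rw [hα p (2 * p + 1) (by simp [selectPos, hp]), hc (2 * (Nat.unpair p).2 + 1),
        interlaceInv_odd, hp]
      unfold rowPos
      rw [show (2 * (Nat.unpair p).2 + 1) / 2 = (Nat.unpair p).2 by omega, ← hp, Nat.pair_unpair]
      omega
    · rw [hα' _ (fun q hq => ?_), hc' _ fun q hq => hp (hrow p q 1 (by norm_num) hq)]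
      unfold selectPos at hq
      split_ifs at hq with h
      · exact hp (by rw [← h, show q = p by omega])
      · omega

theorem wordDistorted_range_annuliGlue :
    WordDistorted (Set.range annuliGlue : Set (ℂ ≃ₜ ℂ)) := by
  let g : ℕ ⊕ Fin 3 → FreeGroup (ℕ ⊕ Fin 3) := FreeGroup.of
  let C : FreeGroup (ℕ ⊕ Fin 3) → FreeGroup (ℕ ⊕ Fin 3) → FreeGroup (ℕ ⊕ Fin 3) :=
    fun a b => a * b * a⁻¹
  let B : ℕ → FreeGroup (ℕ ⊕ Fin 3) := fun n =>
    C (g (.inl (2 * n + 1)))⁻¹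
      (C (g (.inr 0)) (g (.inr 2)) * C (g (.inl (2 * n))) (g (.inr 2))⁻¹)
  refine wordDistorted_range_radial.of_words
    (fun n => C (g (.inr 0))⁻¹ (B n * C (g (.inr 1)) (B n))) fun y hy => ?_
  choose X hX using hy
  set H : ℕ → ℕ → supportedIn (annulus 0) := fun n => partialProd (X n) with hH
  set v : ℕ → supportedIn (annulus 0) := fun p => H (Nat.unpair p).1 (Nat.unpair p).2 with hv
  set V := annuliGlue v with hV
  set ε := annulusShift _ double_strictMono with hε
  set σ := annulusShift Nat.succ natSucc_strictMono with hσ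
  set α := fun n => annulusShift _ (selectPos_strictMono n) with hα
  set γ := fun n => annulusShift _ (rowPos_strictMono n) with hγ
  refine ⟨fun i => if i % 2 = 0 then α (i / 2) else γ (i / 2), ![ε, σ, V], fun i => ?_, fun n => ?_⟩
  · dsimp only
    split_ifs
    exacts [⟨_, rfl⟩, ⟨_, rfl⟩]
  · have h1 : (2 * n + 1) % 2 = 1 := by omega
    have h2 : (2 * n + 1) / 2 = n := by omega
    have hB : (γ n)⁻¹ * (ε * V * ε⁻¹ * (α n * V⁻¹ * (α n)⁻¹)) * γ n =
        annuliGlue (interlaceInv (H n)) := by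
      have e1 := annulusShift_conj (rowPos_strictMono n) (interlaceInv (H n))
      rw [← extend_double_mul_extend_selectPos, map_mul, ← annulusShift_conj double_strictMono,
        ← annulusShift_conj (selectPos_strictMono n)] at e1
      have e2 : annuliGlue (fun p => (H (Nat.unpair p).1 (Nat.unpair p).2)⁻¹) = V⁻¹ := by
        rw [hV, ← map_inv]; rfl
      rw [e2] at e1
      change γ n * annuliGlue (interlaceInv (H n)) * (γ n)⁻¹ =
        ε * V * ε⁻¹ * (α n * V⁻¹ * (α n)⁻¹) at e1
      rw [← e1]; group
    have hfin : ε⁻¹ * (annuliGlue (interlaceInv (H n)) *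
        (σ * annuliGlue (interlaceInv (H n)) * σ⁻¹)) * ε = y n := by
      rw [hσ, annulusShift_conj, ← map_mul, interlaceInv_mul_extend_succ, ← annulusShift_conj
        double_strictMono, hX n, ← hε]
      group
    rw [← hfin, ← hB]
    simp [C, B, g, h1, h2]

end AnnuliDistorted

section Stable

open Complex Filter Topology Metric
open scoped NNReal

theorem Homeomorph.exists_norm_lt (c : ℂ ≃ₜ ℂ) (R : ℝ) :
    ∃ M, 0 < M ∧ R ≤ M ∧ ∀ z, ‖z‖ ≤ R → ‖c z‖ < M := by
  obtain ⟨M, hM⟩ := (isCompact_closedBall (0 : ℂ) R).exists_bound_of_continuousOn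
    c.continuous.continuousOn
  refine ⟨max (max 1 R) (M + 1), by positivity, (le_max_right _ _).trans (le_max_left _ _),
    fun z hz => ?_⟩
  have := hM z (by simpa using hz)
  exact (this.trans_lt (lt_add_one M)).trans_le (le_max_right _ _)

/-- Homeomorphisms of the plane with bounded support. -/
def boundedSupport : Subgroup (ℂ ≃ₜ ℂ) where
  carrier := {f | ∃ R, f ∈ supportedIn (ball 0 R)}
  mul_mem' := by
    rintro f g ⟨R, hR⟩ ⟨R', hR'⟩
    exact ⟨max R R', mul_mem (supportedIn_mono (ball_subset_ball (le_max_left _ _)) hR)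
      (supportedIn_mono (ball_subset_ball (le_max_right _ _)) hR')⟩
  one_mem' := ⟨0, one_mem _⟩
  inv_mem' := by
    rintro f ⟨R, hR⟩
    exact ⟨R, inv_mem hR⟩

theorem boundedSupport_conj {f : ℂ ≃ₜ ℂ} (hf : f ∈ boundedSupport) (c : ℂ ≃ₜ ℂ) :
    c * f * c⁻¹ ∈ boundedSupport := by
  obtain ⟨R, hR⟩ := hf
  obtain ⟨M, -, -, hM⟩ := c.exists_norm_lt R
  refine ⟨M, conj_mem_supportedIn hR c fun z hz => ?_⟩
  rw [mem_ball_zero_iff] at hz ⊢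
  exact hM z hz.le

/-- Homeomorphisms of the plane which agree on every bounded set with one of bounded support. -/
def stableHomeo : Subgroup (ℂ ≃ₜ ℂ) where
  carrier := {f | ∀ R : ℝ, ∃ k ∈ boundedSupport, ∀ z, ‖z‖ ≤ R → k z = f z}
  mul_mem' := by
    intro f g hf hg R
    obtain ⟨M, -, -, hM⟩ := g.exists_norm_lt R
    obtain ⟨k, hk, hkf⟩ := hf M
    obtain ⟨l, hl, hlg⟩ := hg R
    refine ⟨k * l, mul_mem hk hl, fun z hz => ?_⟩
    rw [Homeomorph.group_mul_apply, Homeomorph.group_mul_apply, hlg z hz, hkf _ (hM z hz).le]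
  one_mem' := fun _ => ⟨1, one_mem _, fun _ _ => rfl⟩
  inv_mem' := by
    intro f hf R
    obtain ⟨M, -, -, hM⟩ := f⁻¹.exists_norm_lt R
    obtain ⟨k, hk, hkf⟩ := hf M
    refine ⟨k⁻¹, inv_mem hk, fun z hz => ?_⟩
    rw [Homeomorph.group_inv_apply_eq_iff, hkf _ (hM z hz).le, Homeomorph.group_apply_inv_self]

theorem stableHomeo_conj {f : ℂ ≃ₜ ℂ} (hf : f ∈ stableHomeo) (c : ℂ ≃ₜ ℂ) :
    c * f * c⁻¹ ∈ stableHomeo := by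
  intro R
  obtain ⟨M, -, -, hM⟩ := c⁻¹.exists_norm_lt R
  obtain ⟨k, hk, hkf⟩ := hf M
  refine ⟨c * k * c⁻¹, boundedSupport_conj hk c, fun z hz => ?_⟩
  simp only [Homeomorph.group_mul_apply]
  rw [hkf _ (hM z hz).le]

theorem stableHomeo_of_conj {f : ℂ ≃ₜ ℂ} (c : ℂ ≃ₜ ℂ) (hf : c * f * c⁻¹ ∈ stableHomeo) :
    f ∈ stableHomeo := by
  have := stableHomeo_conj hf c⁻¹
  convert this using 1
  group

theorem boundedSupport_le_stableHomeo : boundedSupport ≤ stableHomeo :=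
  fun f hf _ => ⟨f, hf, fun _ _ => rfl⟩

theorem exists_radius_two_nodes {a A a' A' : ℝ} (ha : 0 < a) (hA : a < A) (ha' : 0 < a')
    (hA' : a' < A') :
    ∃ e : ℝ≥0 ≃o ℝ≥0, (∀ t, 0 ≤ t → t ≤ a → radius e t = a' / a * t) ∧ radius e A = A' ∧
      (A = A' → ∀ t, A ≤ t → radius e t = t) := by
  let b : ℝ → ℝ → ℕ → ℝ := fun x y n => match n with
    | 0 => 0
    | 1 => x
    | n + 2 => y + n
  have hb : ∀ x y, 0 < x → x < y → StrictMono (b x y) := fun x y hx hy => by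
    refine strictMono_nat_of_lt_succ fun n => ?_
    rcases n with _ | _ | n
    · simpa [b] using hx
    · simpa [b] using hy
    · simp [b]
  have hbt : ∀ x y, Tendsto (b x y) atTop atTop := fun x y => by
    rw [← tendsto_add_atTop_iff_nat 2]
    exact tendsto_atTop_add_const_left _ _ tendsto_natCast_atTop_atTop
  obtain ⟨e, he⟩ := exists_radius_piecewise (hb a A ha hA) rfl (hbt a A) (hb a' A' ha' hA') rfl
    (hbt a' A')
  refine ⟨e, fun t h0 h1 => ?_, ?_, ?_⟩
  · have := he 0 (t / a) (by positivity) ((div_le_one ha).2 h1)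
    simp only [b, sub_zero, zero_add] at this
    rw [div_mul_cancel₀ _ ha.ne'] at this
    rw [this]; ring
  · have := he 2 0 le_rfl zero_le_one
    simpa [b] using this
  · rintro rfl t ht
    have h0 : 0 ≤ t - A := sub_nonneg.2 ht
    have := he (⌊t - A⌋₊ + 2) (t - A - ⌊t - A⌋₊) (sub_nonneg.2 (Nat.floor_le h0))
      (by linarith [Nat.lt_floor_add_one (t - A)])
    simp only [b] at this
    push_cast at this
    ring_nf at this
    exact this

/-- A stable homeomorphism mapping a disc into a larger one extends from it with support there. -/
theorem exists_extension_of_stable {f : ℂ ≃ₜ ℂ} (hf : f ∈ stableHomeo) {r R : ℝ} (hr : 0 ≤ r)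
    (hrR : r < R) (h : ∀ z, ‖z‖ ≤ r → ‖f z‖ < R) :
    ∃ k ∈ supportedIn (ball (0 : ℂ) R), ∀ z, ‖z‖ ≤ r → k z = f z := by
  obtain ⟨k, ⟨R', hk⟩, hkf⟩ := hf r
  obtain ⟨z₀, hz₀, hmax⟩ := (isCompact_closedBall (0 : ℂ) r).exists_isMaxOn
    ⟨0, by simpa using hr⟩ (f.continuous.norm.continuousOn)
  set a := max (max r (R / 2)) ‖f z₀‖ with ha
  have hR0 : 0 < R := hr.trans_lt hrR
  have haR : a < R := by
    refine max_lt (max_lt hrR (by linarith)) (h z₀ (by simpa using hz₀))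
  have ha0 : 0 < a := by
    have : R / 2 ≤ a := (le_max_right _ _).trans (le_max_left _ _)
    linarith
  obtain ⟨e, he1, he2, -⟩ := exists_radius_two_nodes (A' := max R R') ha0 haR ha0
    (haR.trans_le (le_max_left _ _))
  have hid : ∀ z, ‖z‖ ≤ a → radial e z = z := fun z hz => by
    rw [radial_apply, he1 _ (norm_nonneg z) hz, div_self ha0.ne', one_mul]
    rcases eq_or_ne z 0 with rfl | hz
    · simp
    · rw [div_self (by simpa using hz)]; simp
  refine ⟨(radial e)⁻¹ * k * (radial e)⁻¹⁻¹, ?_, fun z hz => ?_⟩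
  · refine conj_mem_supportedIn (supportedIn_mono (ball_subset_ball (le_max_right R R')) hk) _
      fun z hz => ?_
    by_contra hn
    rw [mem_ball_zero_iff, not_lt] at hn
    have h1 : radius e R ≤ radius e ‖(radial e)⁻¹ z‖ :=
      (radius_strictMonoOn e).monotoneOn (Set.mem_Ici.2 hR0.le) (Set.mem_Ici.2 (norm_nonneg _)) hn
    rw [← norm_radial, Homeomorph.group_apply_inv_self, he2] at h1
    rw [mem_ball_zero_iff] at hz
    linarith
  · have h1 : ‖f z‖ ≤ a := (hmax (by simpa using hz)).trans (le_max_right _ _)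
    have h2 : r ≤ a := (le_max_left _ _).trans (le_max_left _ _)
    rw [inv_inv, Homeomorph.group_mul_apply, Homeomorph.group_mul_apply, hid z (hz.trans h2),
      hkf z hz, Homeomorph.group_inv_apply_eq_iff, hid _ h1]

/-- The quantitative form of `‖Φ z - z‖ = o(‖z‖)`. -/
def SublinearDisplacement (Φ : ℂ → ℂ) : Prop :=
  ∀ ε > 0, ∃ C, ∀ z, ‖Φ z - z‖ ≤ ε * ‖z‖ + C

theorem SublinearDisplacement.symm {Φ : ℂ ≃ₜ ℂ} (h : SublinearDisplacement Φ) :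
    SublinearDisplacement Φ.symm := by
  intro ε hε
  obtain ⟨C, hC⟩ := h (min (ε / 2) (1 / 2)) (by positivity)
  refine ⟨(ε + 1) * C, fun z => ?_⟩
  set δ := min (ε / 2) (1 / 2)
  have hδ1 : δ ≤ ε / 2 := min_le_left _ _
  have hδ2 : δ ≤ 1 / 2 := min_le_right _ _
  have hδ0 : 0 < δ := by positivity
  have h1 := hC (Φ.symm z)
  rw [Φ.apply_symm_apply, norm_sub_rev] at h1
  have h2 : ‖Φ.symm z‖ ≤ ‖z‖ + ‖Φ.symm z - z‖ := by
    have := norm_add_le z (Φ.symm z - z)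
    rwa [add_sub_cancel] at this
  have hC0 : 0 ≤ C := by
    have := hC 0
    rw [norm_zero, mul_zero, zero_add] at this
    exact (norm_nonneg _).trans this
  have h3 := norm_nonneg (Φ.symm z)
  have h4 := norm_nonneg z
  have h5 : ‖Φ.symm z‖ ≤ 2 * (‖z‖ + C) := by nlinarith
  have h6 : δ * ‖Φ.symm z‖ ≤ ε / 2 * (2 * (‖z‖ + C)) := mul_le_mul hδ1 h5 h3 (by positivity)
  nlinarith

/-- The conjugate of `Φ` by the radial homeomorphism of the plane onto the open unit disc, extended
by the identity. -/
noncomputable def discExtension (Φ : ℂ → ℂ) (w : ℂ) : ℂ :=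
  if ‖w‖ < 1 then
    ((1 + ‖Φ (((1 - ‖w‖)⁻¹ : ℝ) * w)‖)⁻¹ : ℝ) * Φ (((1 - ‖w‖)⁻¹ : ℝ) * w)
  else w

theorem norm_discExpand {w : ℂ} (hw : ‖w‖ < 1) :
    ‖(((1 - ‖w‖)⁻¹ : ℝ) : ℂ) * w‖ = (1 - ‖w‖)⁻¹ * ‖w‖ := by
  rw [norm_mul, Complex.norm_real, Real.norm_eq_abs, abs_of_pos]
  exact inv_pos.2 (sub_pos.2 hw)

theorem norm_discContract (z : ℂ) :
    ‖(((1 + ‖z‖)⁻¹ : ℝ) : ℂ) * z‖ = (1 + ‖z‖)⁻¹ * ‖z‖ := by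
  rw [norm_mul, Complex.norm_real, Real.norm_eq_abs, abs_of_pos]
  positivity

theorem norm_discContract_lt (z : ℂ) : ‖(((1 + ‖z‖)⁻¹ : ℝ) : ℂ) * z‖ < 1 := by
  rw [norm_discContract, inv_mul_lt_iff₀ (by positivity)]
  linarith

theorem discExpand_discContract (z : ℂ) :
    (((1 - ‖(((1 + ‖z‖)⁻¹ : ℝ) : ℂ) * z‖)⁻¹ : ℝ) : ℂ) * ((((1 + ‖z‖)⁻¹ : ℝ) : ℂ) * z) = z := by
  rw [norm_discContract]
  have h : 1 + ‖z‖ ≠ 0 := by positivity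
  have : (1 - (1 + ‖z‖)⁻¹ * ‖z‖)⁻¹ * (1 + ‖z‖)⁻¹ = 1 := by field_simp; simp
  rw [← mul_assoc, ← Complex.ofReal_mul, this]
  simp

theorem discContract_discExpand {w : ℂ} (hw : ‖w‖ < 1) :
    (((1 + ‖(((1 - ‖w‖)⁻¹ : ℝ) : ℂ) * w‖)⁻¹ : ℝ) : ℂ) * ((((1 - ‖w‖)⁻¹ : ℝ) : ℂ) * w) = w := by
  rw [norm_discExpand hw]
  have h : 1 - ‖w‖ ≠ 0 := (sub_pos.2 hw).ne'
  have : (1 + (1 - ‖w‖)⁻¹ * ‖w‖)⁻¹ * (1 - ‖w‖)⁻¹ = 1 := by field_simp; simp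
  rw [← mul_assoc, ← Complex.ofReal_mul, this]
  simp

theorem norm_discContract_sub_le (x y : ℂ) :
    ‖(((1 + ‖x‖)⁻¹ : ℝ) : ℂ) * x - (((1 + ‖y‖)⁻¹ : ℝ) : ℂ) * y‖ ≤ 2 * ‖x - y‖ / (1 + ‖y‖) := by
  have hx : 0 < 1 + ‖x‖ := by positivity
  have hy : 0 < 1 + ‖y‖ := by positivity
  have e : (((1 + ‖x‖)⁻¹ : ℝ) : ℂ) * x - (((1 + ‖y‖)⁻¹ : ℝ) : ℂ) * y =
      (((1 + ‖y‖)⁻¹ : ℝ) : ℂ) * (x - y) +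
        (((1 + ‖x‖)⁻¹ - (1 + ‖y‖)⁻¹ : ℝ) : ℂ) * x := by push_cast; ring
  have h1 : |(1 + ‖x‖)⁻¹ - (1 + ‖y‖)⁻¹| * ‖x‖ ≤ ‖x - y‖ / (1 + ‖y‖) := by
    have : (1 + ‖x‖)⁻¹ - (1 + ‖y‖)⁻¹ = (‖y‖ - ‖x‖) / ((1 + ‖x‖) * (1 + ‖y‖)) := by
      field_simp; ring
    rw [this, abs_div, abs_of_pos (mul_pos hx hy), div_mul_eq_mul_div, div_le_div_iff₀
      (mul_pos hx hy) hy]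
    have h2 : |‖y‖ - ‖x‖| ≤ ‖x - y‖ := by rw [norm_sub_rev]; exact abs_norm_sub_norm_le y x
    have h3 : |‖y‖ - ‖x‖| * ‖x‖ ≤ ‖x - y‖ * (1 + ‖x‖) :=
      mul_le_mul h2 (by linarith) (norm_nonneg _) (norm_nonneg _)
    nlinarith
  rw [e]
  refine (norm_add_le _ _).trans ?_
  rw [norm_mul, norm_mul, Complex.norm_real, Complex.norm_real, Real.norm_eq_abs,
    Real.norm_eq_abs, abs_of_pos (inv_pos.2 hy)]
  calc (1 + ‖y‖)⁻¹ * ‖x - y‖ + |(1 + ‖x‖)⁻¹ - (1 + ‖y‖)⁻¹| * ‖x‖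
      ≤ (1 + ‖y‖)⁻¹ * ‖x - y‖ + ‖x - y‖ / (1 + ‖y‖) := by gcongr
    _ = 2 * ‖x - y‖ / (1 + ‖y‖) := by ring

theorem norm_discExtension_sub_le {Φ : ℂ → ℂ} {ε C : ℝ} (hε : 0 < ε)
    (h : ∀ z, ‖Φ z - z‖ ≤ ε * ‖z‖ + C) {w : ℂ} (hw : ‖w‖ < 1) :
    ‖discExtension Φ w - w‖ ≤ 2 * ε + 2 * C * (1 - ‖w‖) := by
  rw [discExtension, if_pos hw]
  set x := (((1 - ‖w‖)⁻¹ : ℝ) : ℂ) * w with hx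
  have h1 := norm_discContract_sub_le (Φ x) x
  rw [hx, discContract_discExpand hw, ← hx] at h1
  have h0 : 0 < 1 - ‖w‖ := sub_pos.2 hw
  have h2 : 1 + ‖x‖ = (1 - ‖w‖)⁻¹ := by
    rw [hx, norm_discExpand hw]; field_simp; simp
  refine h1.trans ?_
  rw [div_le_iff₀ (by positivity)]
  have h3 : (2 * ε + 2 * C * (1 - ‖w‖)) * (1 + ‖x‖) = 2 * ε * (1 + ‖x‖) + 2 * C := by
    have : (1 - ‖w‖) * (1 + ‖x‖) = 1 := by rw [h2]; field_simp
    linear_combination 2 * C * this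
  rw [h3]
  linarith [h x]

theorem continuous_discExtension {Φ : ℂ → ℂ} (hc : Continuous Φ) (h : SublinearDisplacement Φ) :
    Continuous (discExtension Φ) := by
  rw [continuous_iff_continuousAt]
  intro x
  rcases lt_trichotomy ‖x‖ 1 with hx | hx | hx
  · have ho : {w : ℂ | ‖w‖ < 1} ∈ 𝓝 x := (isOpen_lt continuous_norm continuous_const).mem_nhds hx
    have hd : ContinuousAt (fun w : ℂ => (((1 - ‖w‖)⁻¹ : ℝ) : ℂ) * w) x := by
      have : 1 - ‖x‖ ≠ 0 := (sub_pos.2 hx).ne'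
      fun_prop (disch := assumption)
    have hcd : Continuous fun z : ℂ => (((1 + ‖z‖)⁻¹ : ℝ) : ℂ) * z := by
      have : ∀ z : ℂ, 1 + ‖z‖ ≠ 0 := fun z => by positivity
      fun_prop (disch := exact this _)
    refine ContinuousAt.congr (f := fun w : ℂ => (((1 + ‖Φ ((((1 - ‖w‖)⁻¹ : ℝ) : ℂ) * w)‖)⁻¹ : ℝ)
      : ℂ) * Φ ((((1 - ‖w‖)⁻¹ : ℝ) : ℂ) * w)) ?_ ?_
    · exact (hcd.comp hc).continuousAt.comp hd
    · filter_upwards [ho] with w hw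
      rw [discExtension, if_pos hw]
  · have hfx : discExtension Φ x = x := by rw [discExtension, if_neg (by rw [hx]; exact lt_irrefl _)]
    rw [Metric.continuousAt_iff]
    intro ε hε
    obtain ⟨C, hC⟩ := h (ε / 8) (by positivity)
    have hC0 : 0 ≤ C := by
      have := hC 0
      rw [norm_zero, mul_zero, zero_add] at this
      exact (norm_nonneg _).trans this
    refine ⟨min (ε / 4) (ε / (8 * (C + 1))), by positivity, fun w hw => ?_⟩
    rw [hfx, dist_eq_norm]
    rw [dist_eq_norm] at hw
    have h1 := hw.trans_le (min_le_left _ _)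
    have h2 := hw.trans_le (min_le_right _ _)
    by_cases hw1 : ‖w‖ < 1
    · have h3 := norm_discExtension_sub_le (by positivity) hC hw1
      have h4 : 1 - ‖w‖ ≤ ‖w - x‖ := by
        rw [← hx, norm_sub_rev]; exact norm_sub_norm_le x w
      have h5 : 2 * C * (1 - ‖w‖) ≤ ε / 4 := by
        rw [lt_div_iff₀ (by positivity)] at h2
        nlinarith [norm_nonneg (w - x)]
      have h6 : ‖discExtension Φ w - x‖ ≤ ‖discExtension Φ w - w‖ + ‖w - x‖ := by
        have := norm_add_le (discExtension Φ w - w) (w - x)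
        rwa [sub_add_sub_cancel] at this
      linarith
    · rw [discExtension, if_neg hw1]
      linarith
  · have ho : {w : ℂ | 1 < ‖w‖} ∈ 𝓝 x := (isOpen_lt continuous_const continuous_norm).mem_nhds hx
    refine continuousAt_id.congr ?_
    filter_upwards [ho] with w hw
    rw [discExtension, if_neg (not_lt.2 (le_of_lt hw))]
    rfl

theorem discExtension_discExtension {Φ Ψ : ℂ → ℂ} (h : Function.LeftInverse Φ Ψ) (w : ℂ) :
    discExtension Φ (discExtension Ψ w) = w := by
  by_cases hw : ‖w‖ < 1
  · rw [discExtension]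
    simp only [discExtension, if_pos hw, norm_discContract_lt, if_true, discExpand_discContract]
    rw [h, discContract_discExpand hw]
  · simp only [discExtension, if_neg hw]

theorem exists_radius_contract (M : ℝ) (hM : 0 ≤ M) :
    ∃ e : ℝ≥0 ≃o ℝ≥0, ∀ t, 0 ≤ t → t ≤ M → radius e t = (1 + t)⁻¹ * t := by
  let q : ℝ → ℝ := fun t => if t ≤ M then (1 + t)⁻¹ * t else (1 + M)⁻¹ * M + (t - M)
  have hlt : ∀ s t : ℝ, 0 ≤ s → s < t → (1 + s)⁻¹ * s < (1 + t)⁻¹ * t := fun s t hs hst => by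
    have ht := hs.trans_lt hst
    rw [inv_mul_lt_iff₀ (by positivity), ← mul_assoc, mul_comm (1 + s), mul_assoc,
      lt_inv_mul_iff₀ (by positivity)]
    nlinarith
  have hle : ∀ t : ℝ, 0 ≤ t → t ≤ M → (1 + t)⁻¹ * t ≤ (1 + M)⁻¹ * M := fun t h0 h1 => by
    rcases h1.eq_or_lt with rfl | h
    exacts [le_rfl, (hlt t M h0 h).le]
  have hq0 : ∀ t : ℝ, 0 ≤ t → 0 ≤ q t := fun t ht => by
    simp only [q]
    split_ifs with h
    · positivity
    · have : 0 ≤ (1 + M)⁻¹ * M := by positivity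
      linarith
  let p : ℝ≥0 → ℝ≥0 := fun t => ⟨q t, hq0 t t.2⟩
  have hp : StrictMono p := fun s t hst => by
    refine NNReal.coe_lt_coe.1 ?_
    show q s < q t
    have hst' : (s : ℝ) < t := hst
    simp only [q]
    split_ifs with h1 h2 h2
    · exact hlt s t s.2 hst'
    · have := hle s s.2 h1
      linarith
    · linarith
    · linarith
  have hps : Function.Surjective p := fun y => by
    by_cases hy : (y : ℝ) ≤ (1 + M)⁻¹ * M
    · rw [le_inv_mul_iff₀ (by positivity)] at hy
      have hy1 : (y : ℝ) < 1 := by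
        by_contra h
        push Not at h
        nlinarith
      have h0 : 0 < 1 - (y : ℝ) := by linarith
      have hle : (y : ℝ) / (1 - y) ≤ M := by rw [div_le_iff₀ h0]; nlinarith
      refine ⟨⟨y / (1 - y), div_nonneg y.2 h0.le⟩, NNReal.coe_injective ?_⟩
      show q (y / (1 - y)) = y
      simp only [q, if_pos hle]
      field_simp
      simp
    · push Not at hy
      refine ⟨⟨y - (1 + M)⁻¹ * M + M, by linarith⟩, NNReal.coe_injective ?_⟩
      show q (y - (1 + M)⁻¹ * M + M) = y
      have : ¬ ((y : ℝ) - (1 + M)⁻¹ * M + M ≤ M) := by linarith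
      simp only [q, if_neg this]
      ring
  refine ⟨hp.orderIsoOfSurjective p hps, fun t h0 h1 => ?_⟩
  show q (t.toNNReal : ℝ) = _
  rw [Real.coe_toNNReal t h0]
  simp only [q, if_pos h1]

theorem stableHomeo_of_sublinearDisplacement {Φ : ℂ ≃ₜ ℂ} (h : SublinearDisplacement Φ) :
    Φ ∈ stableHomeo := by
  let k : ℂ ≃ₜ ℂ :=
    { toFun := discExtension Φ
      invFun := discExtension Φ.symm
      left_inv := discExtension_discExtension Φ.symm_apply_apply
      right_inv := discExtension_discExtension Φ.apply_symm_apply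
      continuous_toFun := continuous_discExtension Φ.continuous h
      continuous_invFun := continuous_discExtension Φ.symm.continuous h.symm }
  have hk : k ∈ boundedSupport := ⟨1, fun z hz => by
    rw [mem_ball_zero_iff] at hz
    exact if_neg hz⟩
  intro R
  obtain ⟨M, hM0, hRM, hM⟩ := Φ.exists_norm_lt R
  obtain ⟨e, he⟩ := exists_radius_contract M hM0.le
  have hr : ∀ z, ‖z‖ ≤ M → radial e z = (((1 + ‖z‖)⁻¹ : ℝ) : ℂ) * z := fun z hz => by
    rw [radial_apply, he _ (norm_nonneg z) hz]
    rcases eq_or_ne z 0 with rfl | hz0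
    · simp
    · rw [mul_div_assoc, div_self (by simpa using hz0), mul_one]
  refine ⟨(radial e)⁻¹ * k * (radial e)⁻¹⁻¹, boundedSupport_conj hk _, fun z hz => ?_⟩
  rw [inv_inv, Homeomorph.group_mul_apply, Homeomorph.group_mul_apply, hr z (hz.trans hRM),
    Homeomorph.group_inv_apply_eq_iff, hr _ (hM z hz).le]
  show discExtension Φ _ = _
  rw [discExtension, if_pos (norm_discContract_lt z), discExpand_discContract]

theorem addRight_mem_stableHomeo (a : ℂ) : Homeomorph.addRight a ∈ stableHomeo :=
  stableHomeo_of_sublinearDisplacement fun ε hε => ⟨‖a‖, fun z => by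
    have : 0 ≤ ε * ‖z‖ := by positivity
    simpa using this⟩

/-- Rotation by an angle depending continuously on the norm. -/
noncomputable def twist (θ : ℝ → ℝ) (hθ : Continuous θ) : ℂ ≃ₜ ℂ where
  toFun z := exp (θ ‖z‖ * I) * z
  invFun z := exp (-(θ ‖z‖ * I)) * z
  left_inv z := by
    dsimp only
    rw [norm_mul, norm_exp_ofReal_mul_I, one_mul, ← mul_assoc, ← exp_add]
    simp
  right_inv z := by
    have : ‖exp (-(θ ‖z‖ * I))‖ = 1 := by
      rw [← neg_mul, ← ofReal_neg, norm_exp_ofReal_mul_I]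
    dsimp only
    rw [norm_mul, this, one_mul, ← mul_assoc, ← exp_add]
    simp
  continuous_toFun := by fun_prop
  continuous_invFun := by fun_prop

theorem scaling_mem_stableHomeo (a : ℂ) (ha : a ≠ 0) : scaling a ha ∈ stableHomeo := by
  have h1 : scaling (exp (a.arg * I)) (exp_ne_zero _) ∈ stableHomeo := by
    intro R
    let θ : ℝ → ℝ := fun t => a.arg * max 0 (min 1 (R + 1 - t))
    have hθ : Continuous θ := by fun_prop
    refine ⟨twist θ hθ, ⟨R + 1, fun z hz => ?_⟩, fun z hz => ?_⟩
    · rw [mem_ball_zero_iff, not_lt] at hz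
      have : θ ‖z‖ = 0 := by
        simp only [θ]
        rw [max_eq_left ((min_le_right _ _).trans (by linarith)), mul_zero]
      show exp (θ ‖z‖ * I) * z = z
      simp [this]
    · have : θ ‖z‖ = a.arg := by
        simp only [θ]
        rw [min_eq_left (by linarith), max_eq_right zero_le_one, mul_one]
      show exp (θ ‖z‖ * I) * z = exp (a.arg * I) * z
      rw [this]
  have hn : 0 < ‖a‖ := norm_pos_iff.2 ha
  have h2 : scaling (‖a‖ : ℂ) (by exact_mod_cast hn.ne') ∈ stableHomeo := by
    intro R
    set r := max R 1
    have hr : 0 < r := lt_max_of_lt_right one_pos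
    have har : 0 < ‖a‖ * r := by positivity
    obtain ⟨e, he1, -, he2⟩ := exists_radius_two_nodes (a := r) (A := r + ‖a‖ * r) (a' := ‖a‖ * r)
      (A' := r + ‖a‖ * r) hr (by linarith) har (by linarith)
    refine ⟨radial e, ⟨r + ‖a‖ * r, fun z hz => ?_⟩, fun z hz => ?_⟩
    · rw [mem_ball_zero_iff, not_lt] at hz
      have : ‖z‖ ≠ 0 := by
        intro h
        rw [h] at hz
        linarith
      rw [radial_apply, he2 rfl _ hz, div_self this]
      simp
    · rw [radial_apply, he1 _ (norm_nonneg z) (hz.trans (le_max_left _ _)), scaling_apply]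
      rcases eq_or_ne z 0 with rfl | hz0
      · simp
      · have h3 : ‖z‖ ≠ 0 := by simpa using hz0
        congr 2
        field_simp
  convert mul_mem h2 h1 using 1
  ext z
  rw [Homeomorph.group_mul_apply, scaling_apply, scaling_apply, scaling_apply, ← mul_assoc,
    norm_mul_exp_arg_mul_I]

theorem stableHomeo_of_eq_self_on_ball {h : ℂ ≃ₜ ℂ} {q : ℂ} {ε : ℝ} (hε : 0 < ε)
    (hh : ∀ z ∈ ball q ε, h z = z) : h ∈ stableHomeo := by
  intro R
  set r := max R 1
  have hr : 0 < r := lt_max_of_lt_right one_pos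
  have hl : ((ε / (2 * r) : ℝ) : ℂ) ≠ 0 := by
    have : ε / (2 * r) ≠ 0 := by positivity
    exact_mod_cast this
  obtain ⟨k, hk, hkA⟩ := mul_mem (addRight_mem_stableHomeo q) (scaling_mem_stableHomeo _ hl) R
  refine ⟨h * k⁻¹ * h⁻¹ * k, mul_mem (boundedSupport_conj (inv_mem hk) h) hk, fun z hz => ?_⟩
  have hkz : k z ∈ ball q ε := by
    rw [hkA z hz, Homeomorph.group_mul_apply, scaling_apply]
    simp only [Homeomorph.coe_addRight, mem_ball, dist_add_self_left, norm_mul, Complex.norm_real,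
      Real.norm_eq_abs]
    rw [abs_of_pos (by positivity)]
    calc ε / (2 * r) * ‖z‖ ≤ ε / (2 * r) * r := by
          gcongr
          exact hz.trans (le_max_left _ _)
      _ = ε / 2 := by field_simp
      _ < ε := by linarith
  have : h⁻¹ (k z) = k z := by rw [Homeomorph.group_inv_apply_eq_iff, hh _ hkz]
  simp only [Homeomorph.group_mul_apply]
  rw [this, Homeomorph.group_inv_apply_self]

theorem stableHomeo_of_eqOn_ball {f f' : ℂ ≃ₜ ℂ} (hf' : f' ∈ stableHomeo) {q : ℂ} {ε : ℝ}
    (hε : 0 < ε) (h : ∀ z ∈ ball q ε, f z = f' z) : f ∈ stableHomeo := by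
  have : f'⁻¹ * f ∈ stableHomeo := stableHomeo_of_eq_self_on_ball hε fun z hz => by
    rw [Homeomorph.group_mul_apply, h z hz, Homeomorph.group_inv_apply_self]
  simpa using mul_mem hf' this

end Stable

section Fragmentation

open Complex Filter Topology Metric
open scoped NNReal

theorem mem_annulus_iff_two_pow {l : ℕ} {z : ℂ} :
    z ∈ annulus l ↔ 2 ^ (5 * l) < ‖z‖ ∧ ‖z‖ < 2 ^ (5 * l + 4) := by
  rw [mem_annulus, pow_add, pow_mul]
  norm_num [mul_comm]

theorem notMem_annulus {l : ℕ} {z : ℂ} (h1 : 2 ^ (5 * l + 4) ≤ ‖z‖)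
    (h2 : ‖z‖ ≤ 2 ^ (5 * l + 5)) (l' : ℕ) : z ∉ annulus l' := by
  rw [mem_annulus_iff_two_pow]
  rintro ⟨h3, h4⟩
  have h5 := (pow_lt_pow_iff_right₀ (one_lt_two : (1 : ℝ) < 2)).1 (h1.trans_lt h4)
  have h6 := (pow_lt_pow_iff_right₀ (one_lt_two : (1 : ℝ) < 2)).1 (h3.trans_le h2)
  omega

theorem exists_mem_range_annuliGlue {c : ℕ → ℂ ≃ₜ ℂ} (hc : ∀ l, c l ∈ supportedIn (annulus l)) :
    ∃ P ∈ Set.range annuliGlue, (∀ l, ∀ z ∈ annulus l, P z = c l z) ∧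
      ∀ z, (∀ l, z ∉ annulus l) → P z = z := by
  have hX : ∀ l, (scaling (32 ^ l) (by simp))⁻¹ * c l * (scaling (32 ^ l) (by simp))⁻¹⁻¹ ∈
      supportedIn (annulus 0) := fun l => conj_mem_supportedIn (hc l) _ fun z hz => by
    rwa [scaling_inv_apply, div_mem_annulus_zero]
  refine ⟨annuliGlue fun l => ⟨_, hX l⟩, ⟨_, rfl⟩, fun l z hz => ?_, fun z hz =>
    annuliGlue_apply_of_eq_one _ fun l hl => absurd hl (hz l)⟩
  rw [annuliGlue_apply _ hz]
  simp only [inv_inv, Homeomorph.group_mul_apply, scaling_inv_apply, scaling_apply]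
  rw [mul_div_cancel₀ _ (by simp), mul_div_cancel₀ _ (by simp)]

/-- Stable homeomorphisms which, together with their inverses, at most double the dyadic scale. -/
def dyadicHomeo : Set (ℂ ≃ₜ ℂ) :=
  {g | g ∈ stableHomeo ∧ (∀ (i : ℕ) z, ‖z‖ ≤ 2 ^ i → ‖g z‖ < 2 ^ (i + 1)) ∧
    ∀ (i : ℕ) z, ‖z‖ ≤ 2 ^ i → ‖g⁻¹ z‖ < 2 ^ (i + 1)}

theorem exists_nat_two_pow_le {z : ℂ} (hz : 4 ≤ ‖z‖) :
    ∃ l : ℕ, 2 ^ (5 * l + 2) ≤ ‖z‖ ∧ ‖z‖ < 2 ^ (5 * l + 7) := by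
  obtain ⟨n, h1, h2⟩ := exists_nat_pow_near (show (1 : ℝ) ≤ ‖z‖ by linarith) one_lt_two
  have h3 : (2 : ℝ) ^ 2 < 2 ^ (n + 1) := lt_of_le_of_lt (by linarith) h2
  have h4 := (pow_lt_pow_iff_right₀ (one_lt_two : (1 : ℝ) < 2)).1 h3
  exact ⟨(n - 2) / 5, (pow_le_pow_right₀ one_le_two (by omega)).trans h1,
    h2.trans_le (pow_le_pow_right₀ one_le_two (by omega))⟩

theorem exists_fragmentation {g : ℂ ≃ₜ ℂ} (hg : g ∈ dyadicHomeo) :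
    ∃ P ∈ Set.range annuliGlue, ∃ N ∈ Set.range annuliGlue, ∃ D ∈ supportedIn (ball (0 : ℂ) 4),
      g = P * (scaling 8 (by simp) * N * (scaling 8 (by simp))⁻¹) * D := by
  obtain ⟨hst, hg1, hg2⟩ := hg
  have hex : ∀ i : ℕ, ∃ k ∈ supportedIn (ball (0 : ℂ) (2 ^ (i + 1))),
      ∀ z, ‖z‖ ≤ 2 ^ i → k z = g z := fun i =>
    exists_extension_of_stable hst (by positivity) (pow_lt_pow_right₀ one_lt_two (by simp)) (hg1 i)
  choose k hk hkg using hex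
  have hmono : ∀ {i j : ℕ}, i ≤ j → (2 : ℝ) ^ i ≤ 2 ^ j := fun h => pow_le_pow_right₀ one_le_two h
  have hk1 : ∀ {i : ℕ} {z : ℂ}, 2 ^ (i + 1) ≤ ‖z‖ → k i z = z := fun {i z} h =>
    hk i z (by simpa using h)
  have hk2 : ∀ {i : ℕ} {z : ℂ}, 2 ^ (i + 1) ≤ ‖z‖ → (k i)⁻¹ z = z := fun {i z} h => by
    rw [Homeomorph.group_inv_apply_eq_iff, hk1 h]
  have key : ∀ {i j : ℕ} {z : ℂ}, i < j → ‖k j z‖ ≤ 2 ^ i → ‖z‖ < 2 ^ (i + 1) := by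
    intro i j z hij h
    have h1 := hg2 i _ h
    have h2 := hkg j _ (h1.le.trans (hmono hij))
    rw [Homeomorph.group_apply_inv_self] at h2
    rwa [← (k j).injective h2]
  have hc : ∀ l, k (5 * l + 3) * (k (5 * l + 1))⁻¹ ∈ supportedIn (annulus l) := by
    intro l z hz
    rw [mem_annulus_iff_two_pow, not_and_or, not_lt, not_lt] at hz
    rw [Homeomorph.group_mul_apply]
    rcases hz with hz | hz
    · obtain ⟨y, rfl⟩ := (k (5 * l + 1)).surjective z
      have hy := key (Nat.lt_succ_self _) hz
      rw [Homeomorph.group_inv_apply_self, hkg _ _ (hy.le.trans (hmono (by omega))),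
        hkg _ _ hy.le]
    · rw [hk2 ((hmono (by omega)).trans hz), hk1 hz]
  obtain ⟨P, hP, hP1, hP2⟩ := exists_mem_range_annuliGlue hc
  have hdiv : ∀ {l : ℕ} {z : ℂ}, z / 8 ∈ annulus l ↔ 2 ^ (5 * l + 3) < ‖z‖ ∧
      ‖z‖ < 2 ^ (5 * l + 7) := fun {l z} => by
    have h3 : (2 : ℝ) ^ (5 * l + 3) = 2 ^ (5 * l) * 8 := by rw [pow_add]; norm_num
    have h7 : (2 : ℝ) ^ (5 * l + 7) = 2 ^ (5 * l + 4) * 8 := by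
      rw [show 5 * l + 7 = 5 * l + 4 + 3 from rfl, pow_add]; norm_num
    rw [mem_annulus_iff_two_pow, norm_div, Complex.norm_ofNat,
      lt_div_iff₀ (by norm_num), div_lt_iff₀ (by norm_num), h3, h7]
  have hn : ∀ l, (scaling 8 (by simp))⁻¹ * ((k (5 * l + 3))⁻¹ * k (5 * l + 6)) *
      (scaling 8 (by simp))⁻¹⁻¹ ∈ supportedIn (annulus l) := by
    intro l
    refine conj_mem_supportedIn (U := {z | 2 ^ (5 * l + 3) < ‖z‖ ∧ ‖z‖ < 2 ^ (5 * l + 7)})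
      (fun z hz => ?_) _ fun z hz => ?_
    · rw [Set.mem_ofPred_eq, not_and_or, not_lt, not_lt] at hz
      rw [Homeomorph.group_mul_apply, Homeomorph.group_inv_apply_eq_iff]
      rcases hz with hz | hz
      · rw [hkg _ _ hz, hkg _ _ (hz.trans (hmono (by omega)))]
      · rw [hk1 hz, hk1 ((hmono (by omega)).trans hz)]
    · rw [Set.mem_ofPred_eq] at hz
      rwa [scaling_inv_apply, hdiv]
  obtain ⟨N, hN, hN1, hN2⟩ := exists_mem_range_annuliGlue hn
  have hPk : ∀ {l : ℕ} {w : ℂ}, 2 ^ (5 * l + 2) ≤ ‖w‖ → ‖w‖ ≤ 2 ^ (5 * l + 5) →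
      P w = k (5 * l + 3) w := by
    intro l w h1 h2
    by_cases hw : w ∈ annulus l
    · rw [hP1 l w hw, Homeomorph.group_mul_apply, hk2 h1]
    · rw [mem_annulus_iff_two_pow, not_and_or, not_lt, not_lt] at hw
      have h3 : 2 ^ (5 * l + 4) ≤ ‖w‖ := by
        refine hw.resolve_left fun h => ?_
        have := (pow_le_pow_iff_right₀ (one_lt_two : (1 : ℝ) < 2)).1 (h1.trans h)
        omega
      rw [hP2 w (notMem_annulus h3 h2), hk1 h3]
  set N' := scaling 8 (by simp) * N * (scaling 8 (by simp))⁻¹ with hN'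
  have hN'apply : ∀ z, N' z = 8 * N (z / 8) := fun z => by
    rw [hN', Homeomorph.group_mul_apply, Homeomorph.group_mul_apply, scaling_inv_apply,
      scaling_apply]
  have hmain : ∀ z : ℂ, 4 ≤ ‖z‖ → P (N' z) = g z := by
    intro z hz
    obtain ⟨l, hl1, hl2⟩ := exists_nat_two_pow_le hz
    rcases le_or_gt ‖z‖ (2 ^ (5 * l + 3)) with hz3 | hz3
    · have : N' z = z := by
        rw [hN'apply, hN2 _ fun l' hl' => ?_, mul_div_cancel₀ _ (by norm_num)]
        obtain ⟨h3, h7⟩ := hdiv.1 hl'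
        have h8 := (pow_lt_pow_iff_right₀ (one_lt_two : (1 : ℝ) < 2)).1 (h3.trans_le hz3)
        have h9 := (pow_lt_pow_iff_right₀ (one_lt_two : (1 : ℝ) < 2)).1 (hl1.trans_lt h7)
        omega
      rw [this, hPk hl1 (hz3.trans (hmono (by omega))), hkg _ _ hz3]
    · have hzl : z / 8 ∈ annulus l := hdiv.2 ⟨hz3, hl2⟩
      have hNz : N' z = (k (5 * l + 3))⁻¹ (k (5 * l + 6) z) := by
        rw [hN'apply, hN1 l _ hzl]
        simp only [inv_inv, Homeomorph.group_mul_apply, scaling_inv_apply, scaling_apply]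
        rw [mul_div_cancel₀ _ (by norm_num), mul_div_cancel₀ _ (by norm_num)]
      have hNk : k (5 * l + 3) (N' z) = k (5 * l + 6) z := by
        rw [hNz, Homeomorph.group_apply_inv_self]
      have hNmem : 2 ^ (5 * l + 3) < ‖N' z‖ ∧ ‖N' z‖ < 2 ^ (5 * l + 7) := by
        rw [← hdiv, hN'apply, mul_div_cancel_left₀ _ (by norm_num), hN1 l _ hzl]
        exact apply_mem_of_supportedIn (hn l) hzl
      rcases le_or_gt ‖N' z‖ (2 ^ (5 * l + 5)) with hw | hw
      · rw [hPk ((hmono (by omega)).trans hNmem.1.le) hw, hNk]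
        refine hkg _ _ (key (i := 5 * l + 5) (j := 5 * l + 6) (by omega) ?_).le
        rw [← hNk]
        by_contra h
        push Not at h
        have h1 := hk2 (i := 5 * l + 3) ((hmono (by omega)).trans h.le)
        rw [Homeomorph.group_inv_apply_self] at h1
        rw [← h1] at h
        exact absurd hw h.not_ge
      · have hwk : N' z = k (5 * l + 6) z := by
          rw [← hNk, hk1 ((hmono (by omega)).trans hw.le)]
        have hw' : N' z ∈ annulus (l + 1) := mem_annulus_iff_two_pow.2
          ⟨hw, hNmem.2.trans_le (hmono (by omega))⟩
        rw [hP1 _ _ hw', Homeomorph.group_mul_apply, hwk,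
          show 5 * (l + 1) + 1 = 5 * l + 6 by ring, Homeomorph.group_inv_apply_self]
        exact hkg _ _ (hl2.le.trans (hmono (by omega)))
  refine ⟨P, hP, N, hN, (P * N')⁻¹ * g, fun z hz => ?_,
    (mul_inv_cancel_left (P * N') g).symm⟩
  rw [mem_ball_zero_iff, not_lt] at hz
  rw [Homeomorph.group_mul_apply, Homeomorph.group_inv_apply_eq_iff]
  exact (hmain z hz).symm

theorem wordDistorted_dyadicHomeo : WordDistorted dyadicHomeo := by
  have hD : WordDistorted (supportedIn (ball (0 : ℂ) 4) : Set (ℂ ≃ₜ ℂ)) :=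
    wordDistorted_supportedIn_re_pos.supportedIn_of_mapsTo (Homeomorph.addRight 4) fun z hz => by
      rw [mem_ball_zero_iff] at hz
      have := (abs_le.1 (abs_re_le_norm z)).1
      rw [Set.mem_ofPred_eq, Homeomorph.coe_addRight, add_re, re_ofNat]
      linarith
  refine ((wordDistorted_range_annuliGlue.mul (wordDistorted_range_annuliGlue.conj
    (scaling 8 (by simp)))).mul hD).mono fun g hg => ?_
  obtain ⟨P, hP, N, hN, D, hD, rfl⟩ := exists_fragmentation hg
  refine ⟨_, ⟨P, hP, _, ?_, rfl⟩, D, hD, rfl⟩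
  rw [Set.mem_ofPred_eq]
  simpa [mul_assoc] using hN

theorem exists_radii (g : ℕ → ℂ ≃ₜ ℂ) : ∃ r : ℕ → ℝ, 0 < r 0 ∧ (∀ i, r i + 1 ≤ r (i + 1)) ∧
    ∀ n i, n ≤ i → ∀ z, ‖z‖ ≤ r i → ‖g n z‖ < r (i + 1) := by
  choose B hB0 hB1 hB2 using fun (n : ℕ) (R : ℝ) => (g n).exists_norm_lt R
  let r : ℕ → ℝ := fun i => Nat.rec 1 (fun i R => R + 1 + ∑ n ∈ Finset.range (i + 1), B n R) i
  have hr : ∀ i, r (i + 1) = r i + 1 + ∑ n ∈ Finset.range (i + 1), B n (r i) := fun i => rfl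
  have hr0 : ∀ i, 0 < r i := fun i => by
    induction i with
    | zero => exact one_pos
    | succ i ih =>
      rw [hr]
      have : 0 ≤ ∑ n ∈ Finset.range (i + 1), B n (r i) :=
        Finset.sum_nonneg fun n _ => (hB0 n _).le
      linarith
  refine ⟨r, hr0 0, fun i => ?_, fun n i hni z hz => (hB2 n _ z hz).trans_le ?_⟩
  · rw [hr]
    exact le_add_of_nonneg_right (Finset.sum_nonneg fun n _ => (hB0 n _).le)
  · rw [hr]
    have := Finset.single_le_sum (f := fun n => B n (r i)) (fun n _ => (hB0 n (r i)).le)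
      (Finset.mem_range.2 (Nat.lt_succ_of_le hni))
    have := hr0 i
    linarith

theorem strictMono_and_tendsto_of_add_one_le {r : ℕ → ℝ} (h : ∀ i, r i + 1 ≤ r (i + 1)) :
    StrictMono r ∧ Tendsto r atTop atTop := by
  refine ⟨strictMono_nat_of_lt_succ fun i => by linarith [h i], ?_⟩
  refine tendsto_atTop_mono (f := fun i : ℕ => (i : ℝ) + r 0) (fun i => ?_)
    (tendsto_atTop_add_const_right _ _ tendsto_natCast_atTop_atTop)
  induction i with
  | zero => simp
  | succ i ih =>
    push_cast
    linarith [h i]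

theorem exists_radius_two_pow {r : ℕ → ℝ} (h0 : 0 < r 0) (h : ∀ i, r i + 1 ≤ r (i + 1)) :
    ∃ e : ℝ≥0 ≃o ℝ≥0, ∀ i : ℕ, radius e (2 ^ i) = r i := by
  have key : ∀ s : ℕ → ℝ, 0 < s 0 → (∀ i, s i + 1 ≤ s (i + 1)) → ∃ b : ℕ → ℝ, StrictMono b ∧
      b 0 = 0 ∧ Tendsto b atTop atTop ∧ ∀ i, b (i + 1) = s i := by
    intro s hs0 hs
    obtain ⟨h1, h2⟩ := strictMono_and_tendsto_of_add_one_le hs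
    let b : ℕ → ℝ := fun n => match n with
      | 0 => 0
      | i + 1 => s i
    refine ⟨b, strictMono_nat_of_lt_succ fun i => ?_, rfl, (tendsto_add_atTop_iff_nat 1).1 h2,
      fun i => rfl⟩
    cases i with
    | zero => exact hs0
    | succ i => exact h1 (Nat.lt_succ_self i)
  obtain ⟨b, hb, hb0, hbt, hbs⟩ := key (fun i => 2 ^ i) (by simp) fun i => by
    have : (1 : ℝ) ≤ 2 ^ i := one_le_pow₀ one_le_two
    rw [pow_succ]
    linarith
  obtain ⟨b', hb', hb0', hbt', hbs'⟩ := key r h0 h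
  obtain ⟨e, he⟩ := exists_radius_piecewise hb hb0 hbt hb' hb0' hbt'
  refine ⟨e, fun i => ?_⟩
  have := he (i + 1) 0 le_rfl zero_le_one
  simpa [hbs, hbs'] using this

theorem wordDistorted_stableHomeo : WordDistorted (stableHomeo : Set (ℂ ≃ₜ ℂ)) := by
  refine wordDistorted_dyadicHomeo.of_words (r := 2)
    (fun n => FreeGroup.of (.inr 0) * FreeGroup.of (.inr 1) ^ n * FreeGroup.of (.inl n) *
      (FreeGroup.of (.inr 1) ^ n)⁻¹ * (FreeGroup.of (.inr 0))⁻¹) fun g hg => ?_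
  obtain ⟨r, hr0, hr, hrg⟩ := exists_radii fun n => if n % 2 = 0 then g (n / 2) else (g (n / 2))⁻¹
  have hrg' : ∀ n i, n ≤ i → ∀ z, ‖z‖ ≤ r (2 * i + 1) → ‖g n z‖ < r (2 * (i + 1) + 1) ∧
      ‖(g n)⁻¹ z‖ < r (2 * (i + 1) + 1) := fun n i hni z hz => by
    have h1 := hrg (2 * n) (2 * i + 1) (by omega) z hz
    have h2 := hrg (2 * n + 1) (2 * i + 1) (by omega) z hz
    rw [if_pos (by omega), show 2 * n / 2 = n by omega] at h1
    rw [if_neg (by omega), show (2 * n + 1) / 2 = n by omega] at h2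
    have : _ ≤ r (2 * (i + 1) + 1) := hr (2 * i + 1 + 1)
    exact ⟨by linarith, by linarith⟩
  obtain ⟨e, he⟩ := exists_radius_two_pow (r := fun i => r (2 * i + 1)) (by linarith [hr 0])
    fun i => by
      have : _ ≤ r (2 * (i + 1) + 1) := hr (2 * i + 1 + 1)
      linarith [hr (2 * i + 1)]
  have hle : ∀ {i : ℕ} {z : ℂ}, ‖radial e z‖ ≤ r (2 * i + 1) ↔ ‖z‖ ≤ 2 ^ i := fun {i z} => by
    rw [norm_radial, ← he]
    exact (radius_strictMonoOn e).le_iff_le (norm_nonneg z) (Set.mem_Ici.2 (by positivity))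
  have hlt : ∀ {i : ℕ} {z : ℂ}, ‖radial e z‖ < r (2 * i + 1) ↔ ‖z‖ < 2 ^ i := fun {i z} => by
    rw [norm_radial, ← he]
    exact (radius_strictMonoOn e).lt_iff_lt (norm_nonneg z) (Set.mem_Ici.2 (by positivity))
  have key : ∀ n (f : ℂ ≃ₜ ℂ), (∀ i, n ≤ i → ∀ z, ‖z‖ ≤ r (2 * i + 1) →
      ‖f z‖ < r (2 * (i + 1) + 1)) → ∀ (i : ℕ) z, ‖z‖ ≤ 2 ^ i →
      ‖((scaling (2 ^ n) (by simp))⁻¹ * (radial e)⁻¹ * f * radial e * scaling (2 ^ n) (by simp)) z‖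
        < 2 ^ (i + 1) := by
    intro n f hf i z hz
    simp only [Homeomorph.group_mul_apply, scaling_inv_apply, scaling_apply]
    rw [norm_div, norm_pow, Complex.norm_ofNat, div_lt_iff₀ (by positivity), ← pow_add, ← hlt,
      Homeomorph.group_apply_inv_self, show i + 1 + n = i + n + 1 by ring]
    refine hf (i + n) (by omega) _ (hle.2 ?_)
    rw [norm_mul, norm_pow, Complex.norm_ofNat, pow_add, mul_comm]
    gcongr
  refine ⟨fun n => (scaling (2 ^ n) (by simp))⁻¹ * (radial e)⁻¹ * g n * radial e *
    scaling (2 ^ n) (by simp), ![radial e, scaling 2 (by simp)], fun n => ⟨?_, ?_, ?_⟩, fun n => ?_⟩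
  · have := stableHomeo_conj (stableHomeo_conj (hg n) (radial e)⁻¹)
      (scaling (2 ^ n) (by simp))⁻¹
    simpa [mul_assoc] using this
  · exact key n _ fun i hi z hz => (hrg' n i hi z hz).1
  · have := key n (g n)⁻¹ fun i hi z hz => (hrg' n i hi z hz).2
    simpa only [mul_inv_rev, inv_inv, mul_assoc] using this
  · have hpow : ∀ n : ℕ, scaling 2 (by simp) ^ n = scaling (2 ^ n) (by simp) := fun n => by
      induction n with
      | zero => ext z; simp [scaling_apply]
      | succ n ih =>
        ext z
        simp [pow_succ, ih, scaling_apply, mul_assoc]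
    simp [hpow, mul_assoc]

end Fragmentation

section PeriodicLift

open Complex Filter Topology Metric
open scoped NNReal

/-- The odd extension of an order automorphism of the nonnegative reals. -/
noncomputable def signedRadius (e : ℝ≥0 ≃o ℝ≥0) (t : ℝ) : ℝ := radius e t - radius e (-t)

theorem radius_of_nonpos (e : ℝ≥0 ≃o ℝ≥0) {t : ℝ} (ht : t ≤ 0) : radius e t = 0 := by
  rw [← radius_zero e, radius, radius, Real.toNNReal_of_nonpos ht, Real.toNNReal_zero]

theorem signedRadius_of_nonneg (e : ℝ≥0 ≃o ℝ≥0) {t : ℝ} (ht : 0 ≤ t) :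
    signedRadius e t = radius e t := by
  rw [signedRadius, radius_of_nonpos e (neg_nonpos.2 ht), sub_zero]

theorem signedRadius_neg (e : ℝ≥0 ≃o ℝ≥0) (t : ℝ) : signedRadius e (-t) = -signedRadius e t := by
  rw [signedRadius, signedRadius, neg_neg, neg_sub]

theorem continuous_signedRadius (e : ℝ≥0 ≃o ℝ≥0) : Continuous (signedRadius e) :=
  (continuous_radius e).sub ((continuous_radius e).comp continuous_neg)

theorem abs_signedRadius (e : ℝ≥0 ≃o ℝ≥0) (t : ℝ) : |signedRadius e t| = radius e |t| := by
  rcases le_total 0 t with h | h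
  · rw [signedRadius_of_nonneg e h, abs_of_nonneg (radius_nonneg e t), abs_of_nonneg h]
  · rw [← neg_neg t, signedRadius_neg, abs_neg, abs_neg,
      signedRadius_of_nonneg e (neg_nonneg.2 h), abs_of_nonneg (radius_nonneg e _),
      abs_of_nonneg (neg_nonneg.2 h)]

theorem signedRadius_symm (e : ℝ≥0 ≃o ℝ≥0) (t : ℝ) :
    signedRadius e.symm (signedRadius e t) = t := by
  have key : ∀ s, 0 ≤ s → signedRadius e.symm (signedRadius e s) = s := fun s hs => by
    rw [signedRadius_of_nonneg e hs, signedRadius_of_nonneg _ (radius_nonneg e s),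
      radius_symm e hs]
  rcases le_total 0 t with h | h
  · exact key t h
  · have := key (-t) (neg_nonneg.2 h)
    rw [signedRadius_neg, signedRadius_neg] at this
    exact neg_injective this

theorem abs_signedRadius_sub_of_nonneg (e : ℝ≥0 ≃o ℝ≥0) {s t : ℝ} (hst : 0 ≤ s * t) :
    |signedRadius e s - signedRadius e t| = |radius e |s| - radius e (|t|)| := by
  rcases mul_nonneg_iff.1 hst with ⟨h1, h2⟩ | ⟨h1, h2⟩
  · rw [signedRadius_of_nonneg e h1, signedRadius_of_nonneg e h2, abs_of_nonneg h1,
      abs_of_nonneg h2]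
  · rw [abs_of_nonpos h1, abs_of_nonpos h2, ← signedRadius_of_nonneg e (neg_nonneg.2 h1),
      ← signedRadius_of_nonneg e (neg_nonneg.2 h2), signedRadius_neg, signedRadius_neg,
      neg_sub_neg, abs_sub_comm]

theorem abs_signedRadius_sub_le (e : ℝ≥0 ≃o ℝ≥0) (s t : ℝ) :
    |signedRadius e s - signedRadius e t| ≤ radius e |s| + radius e |t| := by
  rw [← abs_signedRadius, ← abs_signedRadius]
  exact abs_sub _ _

/-- Acting on the real and imaginary parts by odd homeomorphisms of the line. -/
noncomputable def coordinatewise (e e' : ℝ≥0 ≃o ℝ≥0) : ℂ ≃ₜ ℂ where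
  toFun z := signedRadius e z.re + signedRadius e' z.im * I
  invFun z := signedRadius e.symm z.re + signedRadius e'.symm z.im * I
  left_inv z := by
    apply Complex.ext
    · rw [re_add_mul_I, re_add_mul_I, signedRadius_symm]
    · rw [im_add_mul_I, im_add_mul_I, signedRadius_symm]
  right_inv z := by
    apply Complex.ext
    · rw [re_add_mul_I, re_add_mul_I]
      exact signedRadius_symm e.symm _
    · rw [im_add_mul_I, im_add_mul_I]
      exact signedRadius_symm e'.symm _
  continuous_toFun := by
    have := continuous_signedRadius e
    have := continuous_signedRadius e'
    fun_prop
  continuous_invFun := by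
    have := continuous_signedRadius e.symm
    have := continuous_signedRadius e'.symm
    fun_prop

theorem coordinatewise_apply_re (e e' : ℝ≥0 ≃o ℝ≥0) (z : ℂ) :
    (coordinatewise e e' z).re = signedRadius e z.re := re_add_mul_I _ _

theorem coordinatewise_apply_im (e e' : ℝ≥0 ≃o ℝ≥0) (z : ℂ) :
    (coordinatewise e e' z).im = signedRadius e' z.im := im_add_mul_I _ _

/-- There are arbitrarily slowly growing order automorphisms of the nonnegative reals. -/
theorem exists_radius_le_add_two {A : ℝ → ℝ} (hA : Monotone A) :
    ∃ e : ℝ≥0 ≃o ℝ≥0, ∀ s t, 0 ≤ s → t ≤ A s → radius e t ≤ radius e s + 2 := by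
  obtain ⟨b, hb0, hb⟩ : ∃ b : ℕ → ℝ, b 0 = 0 ∧ ∀ n, b (n + 1) = max (b n + 1) (A (b n)) :=
    ⟨fun n => Nat.rec 0 (fun _ R => max (R + 1) (A R)) n, rfl, fun n => rfl⟩
  obtain ⟨hb1, hb2⟩ := strictMono_and_tendsto_of_add_one_le (r := b) fun n => by
    rw [hb]
    exact le_max_left _ _
  obtain ⟨e, he⟩ := exists_radius_interpolating hb1 hb0 hb2
  have heb : ∀ n : ℕ, radius e n = b n := fun n => by simpa using he n 0 le_rfl zero_le_one
  refine ⟨e.symm, fun s t hs ht => ?_⟩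
  rcases le_total t 0 with ht0 | ht0
  · rw [radius_of_nonpos _ ht0]
    linarith [radius_nonneg e.symm s]
  set n := ⌊radius e.symm s⌋₊
  have h1 : radius e.symm s ≤ (n + 1 : ℕ) := by
    push_cast
    exact (Nat.lt_floor_add_one _).le
  have h2 : s ≤ b (n + 1) := by
    rw [← heb, ← radius_symm' e hs]
    exact (radius_strictMonoOn e).monotoneOn (radius_nonneg _ _)
      (Set.mem_Ici.2 (Nat.cast_nonneg _)) h1
  have h3 : t ≤ radius e (n + 1 + 1 : ℕ) := by
    rw [heb, hb]
    exact (ht.trans (hA h2)).trans (le_max_right _ _)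
  have h4 := (radius_strictMonoOn e.symm).monotoneOn ht0 (radius_nonneg _ _) h3
  rw [radius_symm e (Nat.cast_nonneg _)] at h4
  push_cast at h4
  linarith [Nat.floor_le (radius_nonneg e.symm s)]

theorem sublinearDisplacement_of_le_sqrt {Φ : ℂ → ℂ} {C : ℝ}
    (h : ∀ z, ‖Φ z - z‖ ≤ C + 2 * √(‖z‖ + 2)) : SublinearDisplacement Φ := by
  intro ε hε
  refine ⟨C + 2 * ε + 1 / ε, fun z => (h z).trans ?_⟩
  have h1 : 0 ≤ ‖z‖ + 2 := by positivity
  have h2 : 2 * √(‖z‖ + 2) ≤ ε * (‖z‖ + 2) + 1 / ε := by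
    nth_rewrite 2 [← Real.sq_sqrt h1]
    have h3 : 0 ≤ (ε * √(‖z‖ + 2) - 1) ^ 2 / ε := by positivity
    have h4 : (ε * √(‖z‖ + 2) - 1) ^ 2 / ε =
        ε * √(‖z‖ + 2) ^ 2 + 1 / ε - 2 * √(‖z‖ + 2) := by
      field_simp
      ring
    linarith
  linarith

theorem radius_trans_sqrt (e : ℝ≥0 ≃o ℝ≥0) (t : ℝ) :
    radius (e.trans NNReal.sqrt) t = √(radius e t) := by
  simp [radius, NNReal.sqrt, Real.sqrt]

theorem abs_sqrt_sub_sqrt_le_two {a b : ℝ} (ha : 0 ≤ a) (hb : 0 ≤ b) (hab : a ≤ b + 2)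
    (hba : b ≤ a + 2) : |√a - √b| ≤ 2 := by
  have key : ∀ x y : ℝ, 0 ≤ x → 0 ≤ y → x ≤ y + 2 → √x ≤ √y + 2 := fun x y hx hy h => by
    rw [Real.sqrt_le_left (by positivity)]
    nlinarith [Real.sq_sqrt hy, Real.sqrt_nonneg y]
  rw [abs_le]
  constructor <;> linarith [key a b ha hb hab, key b a hb ha hba]

/-- If `F` moves points by an amount bounded in terms of the real part, then it is stable. -/
theorem stableHomeo_of_displacement_le {F : ℂ ≃ₜ ℂ} {a : ℝ → ℝ} {B : ℝ} (ha : Monotone a)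
    (hF : ∀ w, ‖F w - w‖ ≤ a |w.re|) (hF' : ∀ w, ‖F w - w‖ ≤ a |(F w).re|)
    (hB : ∀ w, w.re * (F w).re < 0 → |w.re| ≤ B) : F ∈ stableHomeo := by
  obtain ⟨e, he⟩ := exists_radius_le_add_two (A := fun s => 2 * s + 2 * a s) fun s t hst => by
    have := ha hst
    dsimp only
    linarith
  set Λ := coordinatewise e (e.trans NNReal.sqrt)
  refine stableHomeo_of_conj Λ (stableHomeo_of_sublinearDisplacement ?_)
  refine sublinearDisplacement_of_le_sqrt (C := (2 * radius e |B| + 2) + 2) fun z => ?_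
  obtain ⟨w, rfl⟩ := Λ.surjective z
  rw [Homeomorph.group_mul_apply, Homeomorph.group_mul_apply, Homeomorph.group_inv_apply_self]
  refine (Complex.norm_le_abs_re_add_abs_im _).trans ?_
  have haq : ∀ t, 0 ≤ t → 0 ≤ a t := fun t ht =>
    ((norm_nonneg _).trans (hF 0)).trans (ha (by simpa using ht))
  have ha0 : 0 ≤ a |w.re| := (norm_nonneg _).trans (hF w)
  have hre := (abs_re_le_norm (F w - w)).trans (hF w)
  have hre' := (abs_re_le_norm (F w - w)).trans (hF' w)
  have him := (abs_im_le_norm (F w - w)).trans (hF w)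
  have hnorm : radius e |w.re| ≤ ‖Λ w‖ := by
    rw [← abs_signedRadius, ← coordinatewise_apply_re]
    exact abs_re_le_norm _
  rw [sub_re, sub_im, coordinatewise_apply_re, coordinatewise_apply_re, coordinatewise_apply_im,
    coordinatewise_apply_im]
  rw [sub_re] at hre hre'
  rw [sub_im] at him
  generalize ‖Λ w‖ = ν at *
  have hBw := hB w
  generalize w.re = x at *
  generalize (F w).re = x' at *
  generalize w.im = y at *
  generalize (F w).im = y' at *
  have ha0' : 0 ≤ a |x'| := (abs_nonneg _).trans hre'
  have hx'x : radius e |x'| ≤ radius e |x| + 2 := he _ _ (abs_nonneg x) (by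
    linarith [abs_sub_abs_le_abs_sub x' x, abs_nonneg x])
  have hxx' : radius e |x| ≤ radius e |x'| + 2 := he _ _ (abs_nonneg x') (by
    linarith [abs_sub_abs_le_abs_sub x x', abs_nonneg x', abs_sub_comm x x'])
  have hX : |signedRadius e x' - signedRadius e x| ≤ 2 * radius e |B| + 2 := by
    have hB0 := radius_nonneg e |B|
    rcases le_or_gt 0 (x' * x) with h | h
    · rw [abs_signedRadius_sub_of_nonneg e h, abs_le]
      constructor <;> linarith
    · have h1 := (hBw (by rwa [mul_comm])).trans (le_abs_self B)
      have h2 := (radius_strictMonoOn e).monotoneOn (Set.mem_Ici.2 (abs_nonneg x))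
        (Set.mem_Ici.2 (abs_nonneg B)) h1
      linarith [abs_signedRadius_sub_le e x' x]
  have hY : |signedRadius (e.trans NNReal.sqrt) y' - signedRadius (e.trans NNReal.sqrt) y| ≤
      2 + 2 * √(ν + 2) := by
    by_cases h : |y| ≤ 2 * |x| + 2 * a |x| ∧ |y'| ≤ 2 * |x| + 2 * a |x|
    · have h1 := he _ _ (abs_nonneg x) h.1
      have h2 := he _ _ (abs_nonneg x) h.2
      have h3 := abs_signedRadius_sub_le (e.trans NNReal.sqrt) y' y
      rw [radius_trans_sqrt, radius_trans_sqrt] at h3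
      have h4 : √(radius e |y|) ≤ √(ν + 2) := Real.sqrt_le_sqrt (by linarith)
      have h5 : √(radius e |y'|) ≤ √(ν + 2) := Real.sqrt_le_sqrt (by linarith)
      linarith
    · have hlt : 2 * a |x| < max |y| |y'| := by
        rw [not_and_or, not_le, not_le] at h
        rw [lt_max_iff]
        have := abs_nonneg x
        rcases h with h | h
        · left; linarith
        · right; linarith
      have hy1 := abs_sub_abs_le_abs_sub y y'
      have hy2 := abs_sub_abs_le_abs_sub y' y
      rw [abs_sub_comm] at hy1
      have hle : |y| ≤ 2 * |y'| ∧ |y'| ≤ 2 * |y| := by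
        rcases lt_max_iff.1 hlt with h | h <;> constructor <;> linarith
      have hsign : 0 ≤ y' * y := by
        by_contra hneg
        push Not at hneg
        have : |y' - y| = |y'| + |y| := by
          rcases mul_neg_iff.1 hneg with ⟨h1, h2⟩ | ⟨h1, h2⟩
          · rw [abs_of_pos h1, abs_of_neg h2, abs_of_pos (by linarith)]; ring
          · rw [abs_of_neg h1, abs_of_pos h2, abs_of_neg (by linarith)]; ring
        have := abs_nonneg y
        have := abs_nonneg y'
        rcases lt_max_iff.1 hlt with h | h <;> linarith
      rw [abs_signedRadius_sub_of_nonneg _ hsign, radius_trans_sqrt, radius_trans_sqrt]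
      have h1 := he |y| |y'| (abs_nonneg y) (by linarith [haq |y| (abs_nonneg y)])
      have h2 := he |y'| |y| (abs_nonneg y') (by linarith [haq |y'| (abs_nonneg y')])
      have := abs_sqrt_sub_sqrt_le_two (radius_nonneg e |y'|) (radius_nonneg e |y|) h1 h2
      linarith [Real.sqrt_nonneg (ν + 2)]
  linarith

end PeriodicLift

section ExpLift

open Complex Filter Topology Metric
open scoped NNReal

theorem eq_add_of_exp_sub_eq {u v : ℂ → ℂ} (hu : Continuous u) (hv : Continuous v) {c : ℂ}
    (h : ∀ w, exp (u w) = exp (v w) * c) (w : ℂ) : u w = v w + (u 0 - v 0) := by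
  have hc : ∀ w, exp (u w - v w) = c := fun w => by
    rw [exp_sub, h, mul_div_cancel_left₀ _ (exp_ne_zero _)]
  have : u w - v w = u 0 - v 0 := Complex.isCoveringMap_exp.const_of_comp (hu.sub hv)
    (fun w w' => Subtype.ext ((hc w).trans (hc w').symm)) w 0
  rw [← this]
  ring

theorem exists_exp_lift {f : ℂ → ℂ} (hf : Continuous f) (h0 : ∀ z, f z = 0 → z = 0) :
    ∃ F : ℂ → ℂ, Continuous F ∧ ∀ w, exp (F w) = f (exp w) := by
  have hne : ∀ w, f (exp w) ≠ 0 := fun w h => exp_ne_zero w (h0 _ h)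
  obtain ⟨F, ⟨-, hF⟩, -⟩ := Complex.isCoveringMapOn_exp.existsUnique_continuousMap_lifts
    (⟨fun w => f (exp w), hf.comp continuous_exp⟩ : C(ℂ, ℂ)) (a₀ := 0) (exp_log (hne 0)) hne
  exact ⟨F, F.continuous, fun w => congrFun hF w⟩

theorem exists_homeomorph_exp_lift {f : ℂ ≃ₜ ℂ} (hf : f 0 = 0) :
    ∃ F : ℂ ≃ₜ ℂ, ∀ w, exp (F w) = f (exp w) := by
  obtain ⟨F, hFc, hF⟩ := exists_exp_lift f.continuous fun z hz => f.injective (hz.trans hf.symm)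
  obtain ⟨G, hGc, hG⟩ := exists_exp_lift f.symm.continuous fun z hz => by
    rw [← f.apply_symm_apply z, hz, hf]
  have h1 := eq_add_of_exp_sub_eq (hGc.comp hFc) continuous_id (c := 1) fun w => by
    simp [hG, hF]
  have h2 := eq_add_of_exp_sub_eq (hFc.comp hGc) continuous_id (c := 1) fun w => by
    simp [hG, hF]
  simp only [Function.comp_apply, id] at h1 h2
  have hsurj : Function.Surjective F := fun v => ⟨G (v - (F (G 0) - 0)), by
    rw [h2, sub_add_cancel]⟩
  have hleft : ∀ w, G (F w) - (G (F 0) - 0) = w := fun w => by rw [h1, add_sub_cancel_right]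
  exact ⟨{  toFun := F
            invFun := fun v => G v - (G (F 0) - 0)
            left_inv := hleft
            right_inv := fun v => by
              obtain ⟨w, rfl⟩ := hsurj v
              exact congrArg F (hleft w)
            continuous_toFun := hFc
            continuous_invFun := by fun_prop }, hF⟩

theorem exists_exp_lift_add_period {f F : ℂ ≃ₜ ℂ} (hF : ∀ w, exp (F w) = f (exp w)) :
    ∃ n : ℤ, ∀ w, F (w + 2 * Real.pi * I) = F w + n * (2 * Real.pi * I) := by
  have h1 : ∀ w, exp (F (w + 2 * Real.pi * I)) = exp (F w) * 1 := fun w => by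
    rw [hF, exp_add, exp_two_pi_mul_I, mul_one, mul_one, hF]
  have h2 := eq_add_of_exp_sub_eq (u := fun w => F (w + 2 * Real.pi * I)) (v := F)
    (by fun_prop) (by fun_prop) h1
  obtain ⟨n, hn⟩ := exp_eq_exp_iff_exists_int.1 ((h1 0).trans (mul_one _))
  refine ⟨n, fun w => (h2 w).trans ?_⟩
  rw [hn]
  ring

theorem add_int_mul_period {F : ℂ → ℂ} {m : ℤ}
    (hF : ∀ w, F (w + 2 * Real.pi * I) = F w + m * (2 * Real.pi * I)) (n : ℤ) (w : ℂ) :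
    F (w + n * (2 * Real.pi * I)) = F w + n * (m * (2 * Real.pi * I)) := by
  have : Function.Periodic (fun w => F w - m * w) (2 * Real.pi * I) := fun w => by
    simp only [hF]
    ring
  have h1 : F (w + n * (2 * Real.pi * I)) - m * (w + n * (2 * Real.pi * I)) = F w - m * w :=
    this.int_mul n w
  linear_combination h1

theorem exp_lift_period_eq {f F : ℂ ≃ₜ ℂ} (hF : ∀ w, exp (F w) = f (exp w)) :
    (∀ w, F (w + 2 * Real.pi * I) = F w + 2 * Real.pi * I) ∨
      ∀ w, F (w + 2 * Real.pi * I) = F w - 2 * Real.pi * I := by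
  obtain ⟨n, hn⟩ := exists_exp_lift_add_period hF
  obtain ⟨m, hm⟩ := exists_exp_lift_add_period (f := f⁻¹) (F := F⁻¹) fun w => by
    rw [eq_comm, Homeomorph.group_inv_apply_eq_iff, ← hF, Homeomorph.group_apply_inv_self]
  have h1 := congrArg F (hm 0)
  rw [Homeomorph.group_apply_inv_self, add_int_mul_period hn, Homeomorph.group_apply_inv_self,
    zero_add, zero_add, ← mul_assoc] at h1
  have h2 : m * n = 1 := by
    have : (m : ℂ) * n = 1 := mul_right_cancel₀ two_pi_I_ne_zero (h1.symm.trans (one_mul _).symm)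
    exact_mod_cast this
  rcases Int.isUnit_iff.1 (IsUnit.of_mul_eq_one_right _ h2) with rfl | rfl
  · left
    simpa using hn
  · right
    simpa [sub_eq_add_neg] using hn

theorem exists_displacement_le {F : ℂ → ℂ} (hFc : Continuous F)
    (hF : ∀ w, F (w + 2 * Real.pi * I) = F w + 2 * Real.pi * I) :
    ∃ a : ℝ → ℝ, Monotone a ∧ ∀ w, ‖F w - w‖ ≤ a |w.re| := by
  have hbd : ∀ n : ℕ, ∃ M, ∀ w ∈ closedBall (0 : ℂ) (n + 2 * Real.pi), ‖F w - w‖ ≤ M := fun n =>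
    (isCompact_closedBall _ _).exists_bound_of_continuousOn (by fun_prop)
  choose M hM using hbd
  have hM0 : ∀ n, 0 ≤ M n := fun n => (norm_nonneg _).trans (hM n 0 (by
    exact mem_closedBall_self (by positivity)))
  refine ⟨fun s => ∑ n ∈ Finset.range (⌈s⌉₊ + 1), M n, fun s t hst => ?_, fun w => ?_⟩
  · exact Finset.sum_le_sum_of_subset_of_nonneg
      (Finset.range_mono (by have := Nat.ceil_mono hst; omega)) fun n _ _ => hM0 n
  · set n := ⌊w.im / (2 * Real.pi)⌋
    have hpi : 0 < 2 * Real.pi := by positivity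
    have h1 : F (w + ((-n : ℤ) : ℂ) * (2 * Real.pi * I)) - (w + ((-n : ℤ) : ℂ) * (2 * Real.pi * I)) =
        F w - w := by
      rw [add_int_mul_period (F := F) (m := 1) (by simpa using hF)]
      push_cast
      ring
    rw [← h1]
    refine (hM ⌈|w.re|⌉₊ _ ?_).trans
      (Finset.single_le_sum (fun n _ => hM0 n) (Finset.self_mem_range_succ _))
    rw [mem_closedBall_zero_iff]
    refine (Complex.norm_le_abs_re_add_abs_im _).trans (add_le_add ?_ ?_)
    · simpa using Nat.le_ceil |w.re|
    · have h2 := Int.floor_le (w.im / (2 * Real.pi))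
      have h3 := Int.lt_floor_add_one (w.im / (2 * Real.pi))
      rw [le_div_iff₀ hpi] at h2
      rw [div_lt_iff₀ hpi] at h3
      have h4 : (w + ((-n : ℤ) : ℂ) * (2 * Real.pi * I)).im = w.im - n * (2 * Real.pi) := by
        simp [sub_eq_add_neg]
      rw [h4, abs_le]
      constructor <;> nlinarith

theorem stableHomeo_of_exp_lift {f F : ℂ ≃ₜ ℂ} (hf : f 0 = 0) (hF : ∀ w, exp (F w) = f (exp w))
    (hper : ∀ w, F (w + 2 * Real.pi * I) = F w + 2 * Real.pi * I) : F ∈ stableHomeo := by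
  obtain ⟨a, ha, haF⟩ := exists_displacement_le F.continuous hper
  obtain ⟨a', ha', haF'⟩ := exists_displacement_le (F⁻¹).continuous fun w => by
    rw [Homeomorph.group_inv_apply_eq_iff, hper, Homeomorph.group_apply_inv_self]
  obtain ⟨M, hM0, -, hM⟩ := (f⁻¹).exists_norm_lt 1
  obtain ⟨δ, hδ, hfδ⟩ := Metric.continuousAt_iff.1
    (f.continuous.continuousAt (x := 0)) 1 one_pos
  refine stableHomeo_of_displacement_le (a := fun s => a s + a' s)
    (B := max |Real.log M| |Real.log δ|) (ha.add ha') (fun w => ?_) (fun w => ?_) fun w hw => ?_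
  · have := (norm_nonneg _).trans (haF' w)
    linarith [haF w]
  · have h1 := (norm_nonneg _).trans (haF (F w))
    have h2 := haF' (F w)
    rw [Homeomorph.group_inv_apply_self, norm_sub_rev] at h2
    linarith
  · have hnorm : ‖f (exp w)‖ = Real.exp (F w).re := by rw [← hF, norm_exp]
    rcases mul_neg_iff.1 hw with ⟨h1, h2⟩ | ⟨h1, h2⟩
    · have h3 := hM (f (exp w)) (by rw [hnorm]; exact (Real.exp_lt_one_iff.2 h2).le)
      rw [Homeomorph.group_inv_apply_self, norm_exp, ← Real.lt_log_iff_exp_lt hM0] at h3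
      rw [abs_of_pos h1]
      exact (h3.le.trans (le_abs_self _)).trans (le_max_left _ _)
    · have h3 : δ ≤ ‖exp w‖ := by
        by_contra h
        push Not at h
        have h4 := hfδ (x := exp w) (by simpa using h)
        rw [hf, dist_zero_right, hnorm] at h4
        exact absurd h4 (Real.one_lt_exp_iff.2 h2).not_gt
      rw [norm_exp, ← Real.log_le_iff_le_exp hδ] at h3
      rw [abs_of_neg h1]
      exact ((neg_le_neg h3).trans (neg_le_abs _)).trans (le_max_right _ _)

open Classical in
/-- The homeomorphism near `1` obtained from one near `0` by the exponential chart. -/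
noncomputable def expConj (k : ℂ → ℂ) (z : ℂ) : ℂ := if z ∈ slitPlane then exp (k (log z)) else z

theorem mem_slitPlane_exp_of_norm_lt_two {w : ℂ} (hw : ‖w‖ < 2) :
    exp w ∈ slitPlane ∧ log (exp w) = w := by
  have h1 := abs_le.1 (abs_im_le_norm w)
  have h2 := Real.pi_gt_three
  have h3 : log (exp w) = w := log_exp (by linarith) (by linarith)
  refine ⟨mem_slitPlane_iff_arg.2 ⟨fun h => ?_, exp_ne_zero w⟩, h3⟩
  have h4 := congrArg im h3
  rw [log_im, h] at h4
  linarith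

theorem continuous_expConj {k : ℂ → ℂ} (hk : Continuous k) (hk1 : ∀ w, 1 ≤ ‖w‖ → k w = w) :
    Continuous (expConj k) := by
  rw [continuous_iff_continuousAt]
  intro z
  by_cases hz : z ∈ slitPlane
  · have h1 : ContinuousAt (fun z => exp (k (log z))) z :=
      continuous_exp.continuousAt.comp
        (hk.continuousAt.comp (continuousAt_clog hz))
    refine h1.congr ?_
    filter_upwards [isOpen_slitPlane.mem_nhds hz] with z' hz'
    exact (if_pos hz').symm
  · have hK : IsCompact (exp '' closedBall (0 : ℂ) 1) :=
      (isCompact_closedBall _ _).image continuous_exp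
    have hzK : z ∉ exp '' closedBall (0 : ℂ) 1 := by
      rintro ⟨w, hw, rfl⟩
      rw [mem_closedBall_zero_iff] at hw
      exact hz (mem_slitPlane_exp_of_norm_lt_two (by linarith)).1
    refine continuousAt_id.congr ?_
    filter_upwards [hK.isClosed.isOpen_compl.mem_nhds hzK] with z' hz'
    rw [expConj]
    split_ifs with h
    · rw [hk1, exp_log (slitPlane_ne_zero h)]
      · rfl
      by_contra hlt
      push Not at hlt
      exact hz' ⟨log z', by simpa using hlt.le, exp_log (slitPlane_ne_zero h)⟩
    · rfl

theorem expConj_expConj {k k' : ℂ → ℂ} (hk : ∀ w, ‖w‖ < 1 → ‖k w‖ < 1)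
    (hk1 : ∀ w, 1 ≤ ‖w‖ → k w = w) (hkk' : ∀ w, k' (k w) = w) (z : ℂ) :
    expConj k' (expConj k z) = z := by
  by_cases hz : z ∈ slitPlane
  · rw [expConj.eq_def k z, if_pos hz]
    rcases lt_or_ge ‖log z‖ 1 with h | h
    · obtain ⟨h1, h2⟩ := mem_slitPlane_exp_of_norm_lt_two ((hk _ h).trans one_lt_two)
      rw [expConj, if_pos h1, h2, hkk', exp_log (slitPlane_ne_zero hz)]
    · have h1 := hkk' (log z)
      rw [hk1 _ h] at h1 ⊢
      rw [exp_log (slitPlane_ne_zero hz), expConj, if_pos hz, h1, exp_log (slitPlane_ne_zero hz)]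
  · have h1 : ∀ k, expConj k z = z := fun k => if_neg hz
    rw [h1, h1]

theorem exists_boundedSupport_expConj {k : ℂ ≃ₜ ℂ} (hk : k ∈ supportedIn (ball (0 : ℂ) 1)) :
    ∃ g ∈ boundedSupport, ∀ z ∈ slitPlane, g z = exp (k (log z)) := by
  have hk1 : ∀ k ∈ supportedIn (ball (0 : ℂ) 1), ∀ w, 1 ≤ ‖w‖ → k w = w := fun k hk w hw =>
    hk w (by simpa using hw)
  have hk2 : ∀ k ∈ supportedIn (ball (0 : ℂ) 1), ∀ w, ‖w‖ < 1 → ‖k w‖ < 1 := fun k hk w hw => by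
    rw [← mem_ball_zero_iff] at hw ⊢
    exact apply_mem_of_supportedIn hk hw
  have hk' := inv_mem hk
  refine ⟨{ toFun := expConj k
            invFun := expConj (k⁻¹ : ℂ ≃ₜ ℂ)
            left_inv := expConj_expConj (hk2 k hk) (hk1 k hk) k.group_inv_apply_self
            right_inv := expConj_expConj (hk2 _ hk') (hk1 _ hk') k.group_apply_inv_self
            continuous_toFun := continuous_expConj k.continuous (hk1 k hk)
            continuous_invFun := continuous_expConj (k⁻¹).continuous (hk1 _ hk') },
    ⟨Real.exp 1, fun z hz => ?_⟩, fun z hz => if_pos hz⟩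
  show expConj k z = z
  rw [mem_ball_zero_iff, not_lt] at hz
  rw [expConj]
  split_ifs with h
  · rw [hk1 k hk, exp_log (slitPlane_ne_zero h)]
    refine le_trans ?_ ((le_abs_self _).trans (abs_re_le_norm (log z)))
    rwa [log_re, Real.le_log_iff_exp_le (norm_pos_iff.2 (slitPlane_ne_zero h))]
  · rfl

theorem stableHomeo_of_exp_lift_mem {f F : ℂ ≃ₜ ℂ} (hF : ∀ w, exp (F w) = f (exp w))
    (hst : F ∈ stableHomeo) : f ∈ stableHomeo := by
  have hst' := mul_mem (addRight_mem_stableHomeo (-F 0)) hst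
  set F' := Homeomorph.addRight (-F 0) * F with hF'
  have hF'apply : ∀ w, F w = F 0 + F' w := fun w => by
    rw [hF', Homeomorph.group_mul_apply, Homeomorph.coe_addRight]
    ring
  have hF'0 : F' 0 = 0 := by simpa using hF'apply 0
  obtain ⟨δ, hδ, hFδ⟩ := Metric.continuousAt_iff.1
    (F'.continuous.continuousAt (x := 0)) 1 one_pos
  obtain ⟨k, hk, hkF⟩ := exists_extension_of_stable hst' (r := min (δ / 2) (1 / 2)) (R := 1)
    (by positivity) ((min_le_right _ _).trans_lt (by norm_num)) fun z hz => by
      have : dist z 0 < δ := by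
        rw [dist_zero_right]
        exact (hz.trans (min_le_left _ _)).trans_lt (by linarith)
      simpa [hF'0] using hFδ this
  obtain ⟨g, hg, hgk⟩ := exists_boundedSupport_expConj hk
  have hlog : ∀ᶠ z in 𝓝 (1 : ℂ), z ∈ slitPlane ∧ ‖log z‖ < min (δ / 2) (1 / 2) := by
    refine Filter.Eventually.and (isOpen_slitPlane.mem_nhds one_mem_slitPlane) ?_
    refine (continuousAt_clog one_mem_slitPlane).norm.eventually (gt_mem_nhds ?_)
    simp only [log_one, norm_zero]
    positivity
  obtain ⟨ε, hε, hεlog⟩ := Metric.eventually_nhds_iff_ball.1 hlog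
  refine stableHomeo_of_eqOn_ball (q := 1)
    (mul_mem (scaling_mem_stableHomeo (exp (F 0)) (exp_ne_zero _)) (boundedSupport_le_stableHomeo hg)) hε fun z hz => ?_
  obtain ⟨h1, h2⟩ := hεlog z hz
  rw [Homeomorph.group_mul_apply, scaling_apply, hgk z h1, hkF _ h2.le, ← exp_add, ← hF'apply, hF,
    exp_log (slitPlane_ne_zero h1)]

/-- Complex conjugation. -/
noncomputable def conjHomeo : ℂ ≃ₜ ℂ := conjCLE.toHomeomorph

theorem conjHomeo_apply (z : ℂ) : conjHomeo z = (starRingEnd ℂ) z := rfl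

theorem stableHomeo_or_mul_conj (f : ℂ ≃ₜ ℂ) : f ∈ stableHomeo ∨ f * conjHomeo ∈ stableHomeo := by
  have key : ∀ f : ℂ ≃ₜ ℂ, f 0 = 0 → f ∈ stableHomeo ∨ f * conjHomeo ∈ stableHomeo := by
    intro f hf
    obtain ⟨F, hF⟩ := exists_homeomorph_exp_lift hf
    rcases exp_lift_period_eq hF with h | h
    · exact .inl (stableHomeo_of_exp_lift_mem hF (stableHomeo_of_exp_lift hf hF h))
    · have hFc : ∀ w, exp ((F * conjHomeo) w) = (f * conjHomeo) (exp w) := fun w => by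
        rw [Homeomorph.group_mul_apply, Homeomorph.group_mul_apply, hF, conjHomeo_apply,
          conjHomeo_apply, exp_conj]
      refine .inr (stableHomeo_of_exp_lift_mem hFc (stableHomeo_of_exp_lift ?_ hFc fun w => ?_))
      · rw [Homeomorph.group_mul_apply, conjHomeo_apply, map_zero, hf]
      · have h1 := h ((starRingEnd ℂ) (w + 2 * Real.pi * I))
        have h2 : (starRingEnd ℂ) (w + 2 * Real.pi * I) + 2 * Real.pi * I = (starRingEnd ℂ) w := by
          rw [map_add, map_mul, map_mul, conj_I, conj_ofReal, map_ofNat]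
          ring
        rw [h2] at h1
        rw [Homeomorph.group_mul_apply, Homeomorph.group_mul_apply, conjHomeo_apply,
          conjHomeo_apply]
        linear_combination -h1
  have h1 := addRight_mem_stableHomeo (f 0)
  have h2 : f = Homeomorph.addRight (f 0) * (Homeomorph.addRight (-f 0) * f) := by
    ext z
    simp
  rcases key (Homeomorph.addRight (-f 0) * f) (by simp) with h | h
  · left
    rw [h2]
    exact mul_mem h1 h
  · right
    rw [h2, mul_assoc]
    exact mul_mem h1 h

instance infinite_homeomorph_complex : Infinite (ℂ ≃ₜ ℂ) :=
  Infinite.of_injective (fun a : ℂ => Homeomorph.addRight a) fun a b h => by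
    simpa using congrArg (fun f : ℂ ≃ₜ ℂ => f 0) h

end ExpLift

/-- The homeomorphism group of the Euclidean plane `ℝ²` is strongly distorted. -/
theorem stronglyDistorted_homeo_euclideanPlane :
    StronglyDistorted (EuclideanSpace ℝ (Fin 2) ≃ₜ EuclideanSpace ℝ (Fin 2)) :=
  StronglyDistorted.of_mulEquiv
    (Homeomorph.conjMulEquiv Complex.orthonormalBasisOneI.repr.toHomeomorph)
    (wordDistorted_stableHomeo.stronglyDistorted conjHomeo stableHomeo_or_mul_conj)
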